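/- Let F be a field of characteristic 2 and E = F(α) a simple field extension of degree 4, where the minimal polynomial of α is f(X) = X⁴ + aX³ + bX² + cX + d with: b = 0 and a ≠ 0 if E/F is separable; a = c = 0 and b ≠ 0 if E/F is inseparable but not purely inseparable; a = b = c = 0 if E/F is purely inseparable. Let f_C(X) = X³ + bX² + acX + (a²d + c²) be the cubic resolvent. Then the kernel W_q(E/F) of the restriction map W_qF → W_qE is generated as a module over the Witt ring WF by: (a) the forms [1,g] for those g ∈ F such that F(℘⁻¹(g)) ⊆ E; (b) the 2-fold quadratic Pfister forms ⟨⟨g,h]] for h ∈ F and those g ∈ F* such that F(√g) ⊆ E; (c) the 2-fold quadratic Pfister forms ⟨⟨f_C(e), d/e²]] for e ∈ F* with f_C(e) ≠ 0; and (d) (only in the case a = c = 0, b ≠ 0) the 3-fold quadratic Pfister forms ⟨⟨b,d,h]] for h ∈ F. -/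

import Mathlib

open QuadraticMap

variable (F : Type) [Field F]

/-- Quadratic forms on `Fin n → F`. -/
abbrev QF (n : ℕ) := QuadraticForm F (Fin n → F)

/-- The nonsingular binary quadratic form `[a,b] = a x² + x y + b y²`. -/
noncomputable def binQF (a b : F) : QF F 2 :=
  (Matrix.of ![![a, 1], ![0, b]]).toQuadraticMap'

/-- The totally singular diagonal quadratic form `⟨c₁, …, c_n⟩ = Σ cᵢ xᵢ²`. -/
noncomputable def diagQF {n : ℕ} (c : Fin n → F) : QF F n :=
  QuadraticMap.weightedSumSquares F c

/-- Orthogonal sum of a finite family of quadratic forms of the same dimension. -/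
noncomputable def oSumFam {k n : ℕ} (q : Fin k → QF F n) : QF F (k * n) :=
  (QuadraticMap.pi q).comp
    ((LinearEquiv.curry F F (Fin k) (Fin n)).toLinearMap.comp
      (LinearEquiv.funCongrLeft F F finProdFinEquiv).toLinearMap)

/-- Orthogonal sum of two quadratic forms. -/
noncomputable def oSum {n m : ℕ} (q₁ : QF F n) (q₂ : QF F m) : QF F (n + m) :=
  (QuadraticMap.prod q₁ q₂).comp
    ((LinearEquiv.sumArrowLequivProdArrow (Fin n) (Fin m) F F).toLinearMap.comp
      (LinearEquiv.funCongrLeft F F finSumFinEquiv).toLinearMap)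

section General
variable {M N : Type} [AddCommGroup M] [Module F M] [AddCommGroup N] [Module F N]

/-- Two quadratic forms are isometric if there is an isometry (isomorphism preserving the
form) between them. -/
def QIsometric (q₁ : QuadraticForm F M) (q₂ : QuadraticForm F N) : Prop :=
  Nonempty (QuadraticMap.IsometryEquiv q₁ q₂)

/-- `q₁` is dominated by `q₂` (written `q₁ ≺ q₂`) if there is an injective linear map `t`
with `q₁ x = q₂ (t x)` for all `x`. -/
def Dominates (q₁ : QuadraticForm F M) (q₂ : QuadraticForm F N) : Prop :=
  ∃ t : M →ₗ[F] N, Function.Injective t ∧ ∀ x, q₁ x = q₂ (t x)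

/-- A quadratic form is nonsingular if the radical of its polar form is trivial. -/
def Nonsingular (q : QuadraticForm F M) : Prop :=
  ∀ x, (∀ y, polar q x y = 0) → x = 0

/-- A quadratic form is totally singular if its polar form vanishes identically. -/
def TotallySingular (q : QuadraticForm F M) : Prop :=
  ∀ x y, polar q x y = 0

/-- A quadratic form is hyperbolic if it is isometric to an orthogonal sum of
hyperbolic planes `ℍ = [0,0]`. -/
def Hyperbolic (q : QuadraticForm F M) : Prop :=
  ∃ k : ℕ, QIsometric F q (oSumFam F fun _ : Fin k => binQF F 0 0)

/-- Witt equivalence: two quadratic forms are Witt equivalent iff they have isometric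
anisotropic parts, i.e. both are isometric to `i × ℍ ⊥ ρ ⊥ j × ⟨0⟩` for a common
anisotropic form `ρ`. -/
def WittEquiv (q₁ : QuadraticForm F M) (q₂ : QuadraticForm F N) : Prop :=
  ∃ (r : ℕ) (ρ : QF F r), ρ.Anisotropic ∧
    (∃ i j : ℕ, QIsometric F q₁
      (oSum F (oSum F (oSumFam F fun _ : Fin i => binQF F 0 0) ρ) (diagQF F (0 : Fin j → F)))) ∧
    (∃ i j : ℕ, QIsometric F q₂
      (oSum F (oSum F (oSumFam F fun _ : Fin i => binQF F 0 0) ρ) (diagQF F (0 : Fin j → F))))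

end General

/-- The Gram-type matrix of a quadratic form on `Fin n → F`: diagonal entries are the values
on basis vectors, above-diagonal entries the polar values. -/
noncomputable def qMat {n : ℕ} (q : QF F n) : Matrix (Fin n) (Fin n) F :=
  Matrix.of fun i j =>
    if i = j then q (Pi.single i 1)
    else if i < j then polar q (Pi.single i 1) (Pi.single j 1) else 0

/-- Scalar extension of a quadratic form along `F → E`. -/
noncomputable def extQF (E : Type) [CommRing E] [Algebra F E] {n : ℕ} (q : QF F n) :
    QuadraticForm E (Fin n → E) :=
  ((qMat F q).map (algebraMap F E)).toQuadraticMap'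

/-- Membership of the Witt class of `q` in the kernel `W_q(E/F)` of `W_qF → W_qE`:
the scalar extension of `q` is Witt equivalent to the zero form. -/
def InWqKernel (E : Type) [Field E] [Algebra F E] {n : ℕ} (q : QF F n) : Prop :=
  WittEquiv E (extQF F E q) (0 : QF E 0)

/-- The 2-fold quadratic Pfister form `⟨⟨g,h]] = ⟨1,g⟩_b ⊗ [1,h] = [1,h] ⊥ g[1,h]`. -/
noncomputable def pf2 (g h : F) : QF F 4 :=
  oSum F (binQF F 1 h) (g • binQF F 1 h)

/-- The 3-fold quadratic Pfister form `⟨⟨g₁,g₂,h]] = ⟨1,g₁⟩_b ⊗ ⟨1,g₂⟩_b ⊗ [1,h]`. -/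
noncomputable def pf3 (g₁ g₂ h : F) : QF F 8 :=
  oSum F (pf2 F g₂ h) (g₁ • pf2 F g₂ h)

/-- Orthogonal sum of a list of quadratic forms of varying dimensions. -/
noncomputable def listOSum : List (Σ n, QF F n) → Σ n, QF F n
  | [] => ⟨0, 0⟩
  | x :: L => ⟨x.1 + (listOSum L).1, oSum F x.2 (listOSum L).2⟩

/-- The cubic resolvent `f_C(X) = X³ + bX² + acX + (a²d + c²)` of
`f(X) = X⁴ + aX³ + bX² + cX + d`, evaluated at `e`. -/
def cubicResolvent (a b c d e : F) : F := e ^ 3 + b * e ^ 2 + a * c * e + (a ^ 2 * d + c ^ 2)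

/-- The generators of `W_q(E/F)` from the main theorem: (a) `[1,g]` with `℘⁻¹(g) ∈ E`;
(b) `⟨⟨g,h]]` with `√g ∈ E`; (c) `⟨⟨f_C(e), d/e²]]`; (d) (only in case 2) `⟨⟨b,d,h]]`. -/
def IsQuarticGen (F : Type) [Field F] (E : Type) [Field E] [Algebra F E]
    (a b c d : F) (case2 : Prop) (x : Σ n, QF F n) : Prop :=
  (∃ g : F, (∃ β : E, β ^ 2 + β + algebraMap F E g = 0) ∧ x = ⟨2, binQF F 1 g⟩) ∨
  (∃ g h : F, g ≠ 0 ∧ (∃ β : E, β ^ 2 = algebraMap F E g) ∧ x = ⟨4, pf2 F g h⟩) ∨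
  (∃ e : F, e ≠ 0 ∧ cubicResolvent F a b c d e ≠ 0 ∧
      x = ⟨4, pf2 F (cubicResolvent F a b c d e) (d / e ^ 2)⟩) ∨
  (case2 ∧ ∃ h : F, x = ⟨8, pf3 F b d h⟩)

section WittTheory

variable {F}
variable {U V V₁ V₂ V₃ V₄ : Type} [AddCommGroup U] [Module F U] [AddCommGroup V] [Module F V]
  [AddCommGroup V₁] [Module F V₁] [AddCommGroup V₂] [Module F V₂]
  [AddCommGroup V₃] [Module F V₃] [AddCommGroup V₄] [Module F V₄]

/-- A quadratic form is metabolic if it vanishes on a subspace of at least half the dimension. -/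
def Metabolic (q : QuadraticForm F V) : Prop :=
  ∃ L : Submodule F V, (∀ x ∈ L, q x = 0) ∧ Module.finrank F V ≤ 2 * Module.finrank F L

lemma Metabolic.of_injective [FiniteDimensional F U] {q : QuadraticForm F V} (g : U →ₗ[F] V)
    (hg : Function.Injective g) (hq : ∀ u, q (g u) = 0)
    (hd : Module.finrank F V ≤ 2 * Module.finrank F U) : Metabolic q := by
  refine ⟨LinearMap.range g, ?_, ?_⟩
  · rintro _ ⟨u, rfl⟩
    exact hq u
  · rwa [LinearMap.finrank_range_of_inj hg]

lemma Metabolic.of_isometry [FiniteDimensional F V₁] {q₁ : QuadraticForm F V₁}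
    {q₂ : QuadraticForm F V₂} (h : Metabolic q₁) (f : V₁ ≃ₗ[F] V₂) (hf : ∀ x, q₂ (f x) = q₁ x) :
    Metabolic q₂ := by
  obtain ⟨L, hL, hd⟩ := h
  refine Metabolic.of_injective (f.toLinearMap ∘ₗ L.subtype)
    (f.injective.comp L.injective_subtype) (fun u => ?_) ?_
  · simpa [hf] using hL u u.2
  · rwa [← f.finrank_eq]

lemma Metabolic.prod [FiniteDimensional F V₁] [FiniteDimensional F V₂] {q₁ : QuadraticForm F V₁}
    {q₂ : QuadraticForm F V₂} (h₁ : Metabolic q₁) (h₂ : Metabolic q₂) :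
    Metabolic (q₁.prod q₂) := by
  obtain ⟨L, hL, hd⟩ := h₁
  obtain ⟨L', hL', hd'⟩ := h₂
  refine Metabolic.of_injective (L.subtype.prodMap L'.subtype)
    (Function.Injective.prodMap L.injective_subtype L'.injective_subtype) (fun u => ?_) ?_
  · simp [hL u.1 u.1.2, hL' u.2 u.2.2]
  · simp only [Module.finrank_prod]
    omega

lemma metabolic_prod_self [CharP F 2] [FiniteDimensional F V] (q : QuadraticForm F V) :
    Metabolic (q.prod q) := by
  refine Metabolic.of_injective (LinearMap.id.prod LinearMap.id)
    (fun x y h => (Prod.ext_iff.1 h).1) (fun u => ?_) ?_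
  · simp [CharTwo.add_self_eq_zero]
  · simp only [Module.finrank_prod]
    omega

lemma Metabolic.swap [FiniteDimensional F V₁] [FiniteDimensional F V₂] {q₁ : QuadraticForm F V₁}
    {q₂ : QuadraticForm F V₂} (h : Metabolic (q₁.prod q₂)) : Metabolic (q₂.prod q₁) :=
  h.of_isometry (LinearEquiv.prodComm F V₁ V₂) (by simp [add_comm])

lemma polar_eq_zero_of_isotropic {q : QuadraticForm F V} {L : Submodule F V}
    (hL : ∀ x ∈ L, q x = 0) {x y : V} (hx : x ∈ L) (hy : y ∈ L) : polar q x y = 0 := by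
  simp [polar, hL _ hx, hL _ hy, hL _ (L.add_mem hx hy)]

lemma Nonsingular.polarBilin_injective {q : QuadraticForm F V} (hq : Nonsingular F q) :
    Function.Injective (polarBilin q : V →ₗ[F] V →ₗ[F] F) := by
  rw [injective_iff_map_eq_zero]
  intro x hx
  exact hq x fun y => by simpa using LinearMap.congr_fun hx y

lemma Nonsingular.finrank_add_le [FiniteDimensional F V] {q : QuadraticForm F V}
    (hq : Nonsingular F q) {K W : Submodule F V} (h : ∀ x ∈ K, ∀ y ∈ W, polar q x y = 0) :
    Module.finrank F K + Module.finrank F W ≤ Module.finrank F V := by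
  let B : V →ₗ[F] Module.Dual F V := polarBilin q
  have hB : Function.Injective B := hq.polarBilin_injective
  have hK : K.map B ≤ W.dualAnnihilator := by
    rintro _ ⟨x, hx, rfl⟩
    rw [Submodule.mem_dualAnnihilator]
    exact fun w hw => h x hx w hw
  have h1 := Submodule.finrank_mono hK
  have h2 := Subspace.finrank_add_finrank_dualAnnihilator_eq W
  rw [← (Submodule.equivMapOfInjective B hB K).finrank_eq] at h1
  omega

/-- The composite of two totally isotropic correspondences, each of at least half the dimension,
is again of at least half the dimension. -/
lemma metabolic_of_correspondences [CharP F 2] {U' : Type} [AddCommGroup U'] [Module F U']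
    [FiniteDimensional F U] [FiniteDimensional F U'] [FiniteDimensional F V₁]
    [FiniteDimensional F V₂] [FiniteDimensional F V₃] {q₁ : QuadraticForm F V₁}
    {q₂ : QuadraticForm F V₂} {q₃ : QuadraticForm F V₃} (hq : Nonsingular F q₂)
    (a : U →ₗ[F] V₁) (b : U →ₗ[F] V₂) (c : U' →ₗ[F] V₂) (e : U' →ₗ[F] V₃)
    (hab : ∀ u, a u = 0 → b u = 0 → u = 0) (hce : ∀ u, c u = 0 → e u = 0 → u = 0)
    (h₁ : ∀ u, q₁ (a u) = q₂ (b u)) (h₂ : ∀ u, q₂ (c u) = q₃ (e u))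
    (hd : Module.finrank F V₁ + 2 * Module.finrank F V₂ + Module.finrank F V₃ ≤
      2 * (Module.finrank F U + Module.finrank F U')) : Metabolic (q₁.prod q₃) := by
  let D : (U × U') →ₗ[F] V₂ := b.coprod (-c)
  have hD : ∀ p, D p = b p.1 - c p.2 := fun p => by simp [D, sub_eq_add_neg]
  let G₀ : (U × U') →ₗ[F] V₁ × V₃ := a.prodMap e
  let P : Submodule F (U × U') := LinearMap.ker D
  let G : P →ₗ[F] V₁ × V₃ := G₀.domRestrict P
  have hP : ∀ p ∈ P, b p.1 = c p.2 := fun p hp => by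
    rwa [LinearMap.mem_ker, hD, sub_eq_zero] at hp
  have hker : Module.finrank F (LinearMap.ker G) + Module.finrank F (LinearMap.range D) ≤
      Module.finrank F V₂ := by
    let J : LinearMap.ker G →ₗ[F] V₂ :=
      b ∘ₗ LinearMap.fst F U U' ∘ₗ P.subtype ∘ₗ (LinearMap.ker G).subtype
    have hz : ∀ p : LinearMap.ker G, a p.1.1.1 = 0 ∧ e p.1.1.2 = 0 := fun p =>
      Prod.ext_iff.1 (LinearMap.mem_ker.1 p.2)
    have hJ : Function.Injective J := fun x y hxy => by
      have hb : b x.1.1.1 = b y.1.1.1 := hxy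
      refine Subtype.ext (Subtype.ext (Prod.ext ?_ ?_)) <;> rw [← sub_eq_zero]
      · refine hab _ ?_ ?_
        · rw [map_sub, (hz x).1, (hz y).1, sub_zero]
        · rw [map_sub, hb, sub_self]
      · refine hce _ ?_ ?_
        · rw [map_sub, ← hP _ x.1.2, ← hP _ y.1.2, hb, sub_self]
        · rw [map_sub, (hz x).2, (hz y).2, sub_zero]
    rw [← LinearMap.finrank_range_of_inj hJ]
    refine hq.finrank_add_le ?_
    rintro _ ⟨p, rfl⟩ _ ⟨w, rfl⟩
    have e1 : polar q₁ (a p.1.1.1) (a w.1) = polar q₂ (b p.1.1.1) (b w.1) := by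
      simp only [polar, ← map_add, h₁]
    have e2 : polar q₂ (c p.1.1.2) (c w.2) = polar q₃ (e p.1.1.2) (e w.2) := by
      simp only [polar, ← map_add, h₂]
    rw [(hz p).1, QuadraticMap.polar_zero_left] at e1
    rw [(hz p).2, QuadraticMap.polar_zero_left, ← hP _ p.1.2] at e2
    change polar q₂ (b p.1.1.1) (D w) = 0
    rw [hD, QuadraticMap.polar_sub_right, ← e1, e2, sub_zero]
  have e1 := LinearMap.finrank_range_add_finrank_ker D
  have e2 := LinearMap.finrank_range_add_finrank_ker G
  change _ + Module.finrank F P = _ at e1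
  rw [Module.finrank_prod] at e1
  refine ⟨LinearMap.range G, ?_, ?_⟩
  · rintro _ ⟨p, rfl⟩
    change q₁ (a p.1.1) + q₃ (e p.1.2) = 0
    rw [h₁, ← h₂, hP _ p.2, CharTwo.add_self_eq_zero]
  · rw [Module.finrank_prod]
    omega

/-- Being Witt equivalent, phrased as metabolicity of the orthogonal sum, is transitive. -/
theorem Metabolic.trans [CharP F 2] [FiniteDimensional F V₁] [FiniteDimensional F V₂]
    [FiniteDimensional F V₃] {q₁ : QuadraticForm F V₁} {q₂ : QuadraticForm F V₂}
    {q₃ : QuadraticForm F V₃} (hq : Nonsingular F q₂) (h₁ : Metabolic (q₁.prod q₂))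
    (h₂ : Metabolic (q₂.prod q₃)) : Metabolic (q₁.prod q₃) := by
  obtain ⟨L, hL, hLd⟩ := h₁
  obtain ⟨M, hM, hMd⟩ := h₂
  rw [Module.finrank_prod] at hLd hMd
  refine metabolic_of_correspondences hq (LinearMap.fst F V₁ V₂ ∘ₗ L.subtype)
    (LinearMap.snd F V₁ V₂ ∘ₗ L.subtype) (LinearMap.fst F V₂ V₃ ∘ₗ M.subtype)
    (LinearMap.snd F V₂ V₃ ∘ₗ M.subtype) (fun u h h' => Subtype.ext (Prod.ext h h'))
    (fun u h h' => Subtype.ext (Prod.ext h h')) (fun u => ?_) (fun u => ?_) (by omega)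
  · exact CharTwo.add_eq_zero.1 (hL _ u.2)
  · exact CharTwo.add_eq_zero.1 (hM _ u.2)

lemma metabolic_prod_zero [FiniteDimensional F V] {q : QuadraticForm F V} (h : Metabolic q) :
    Metabolic (q.prod (0 : QF F 0)) :=
  h.prod ⟨⊤, fun _ _ => rfl, by simp⟩

/-- Witt cancellation of metabolic forms. -/
theorem Metabolic.cancel [CharP F 2] [FiniteDimensional F V₁] [FiniteDimensional F V₂]
    {q₁ : QuadraticForm F V₁} {q₂ : QuadraticForm F V₂} (hq : Nonsingular F q₂)
    (h : Metabolic (q₁.prod q₂)) (h₂ : Metabolic q₂) : Metabolic q₁ := by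
  obtain ⟨L, hL, hd⟩ := h.trans hq (metabolic_prod_zero h₂)
  refine Metabolic.of_injective (LinearMap.fst F V₁ (Fin 0 → F) ∘ₗ L.subtype)
    (fun x y hxy => Subtype.ext (Prod.ext hxy (Subsingleton.elim _ _))) (fun u => ?_) ?_
  · simpa using hL _ u.2
  · simpa using hd

end WittTheory

section WittDecomposition

variable {F}
variable {V V₁ V₂ : Type} [AddCommGroup V] [Module F V]
  [AddCommGroup V₁] [Module F V₁] [AddCommGroup V₂] [Module F V₂]

lemma eq_zero_of_mem_span_of_isotropic {q : QuadraticForm F V} {S : Set V}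
    (hS : ∀ x ∈ S, q x = 0) (hS' : ∀ x ∈ S, ∀ y ∈ S, polar q x y = 0) {x : V}
    (hx : x ∈ Submodule.span F S) : q x = 0 := by
  have h1 : ∀ y ∈ S, ∀ x ∈ Submodule.span F S, polar q x y = 0 := fun y hy x hx => by
    induction hx using Submodule.span_induction with
    | mem x hx => exact hS' x hx y hy
    | zero => simp
    | add x z _ _ hx hz => rw [QuadraticMap.polar_add_left, hx, hz, add_zero]
    | smul c x _ hx => rw [QuadraticMap.polar_smul_left, hx, smul_zero]
  have h2 : ∀ x ∈ Submodule.span F S, ∀ y ∈ Submodule.span F S, polar q x y = 0 :=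
    fun x hx y hy => by
      induction hy using Submodule.span_induction with
      | mem y hy => exact h1 y hy x hx
      | zero => simp
      | add y z _ _ hy hz => rw [QuadraticMap.polar_add_right, hy, hz, add_zero]
      | smul c y _ hy => rw [QuadraticMap.polar_smul_right, hy, smul_zero]
  induction hx using Submodule.span_induction with
  | mem x hx => exact hS x hx
  | zero => simp
  | add x z hx' hz' hx hz => rw [QuadraticMap.map_add q, hx, hz, h2 x hx' z hz']; simp
  | smul c x _ hx => rw [QuadraticMap.map_smul, hx, smul_zero]

/-- A nonsingular form realises arbitrary polar values against linearly independent vectors. -/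
lemma Nonsingular.exists_polar_eq [FiniteDimensional F V] {q : QuadraticForm F V}
    (hq : Nonsingular F q) {ι : Type} {e : ι → V} (he : LinearIndependent F e) (t : ι → F) :
    ∃ w, ∀ i, polar q (e i) w = t i := by
  obtain ⟨g, hg⟩ := LinearMap.exists_extend ((Module.Basis.span he).constr F t)
  let B : V →ₗ[F] Module.Dual F V := polarBilin q
  have hB : Function.Surjective B :=
    (LinearMap.injective_iff_surjective_of_finrank_eq_finrank
      (Subspace.dual_finrank_eq (K := F) (V := V)).symm).1 hq.polarBilin_injective
  obtain ⟨w, hw⟩ := hB g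
  refine ⟨w, fun i => ?_⟩
  have h1 : polar q w (e i) = g (e i) := LinearMap.congr_fun hw (e i)
  have h2 := LinearMap.congr_fun hg (Module.Basis.span he i)
  rw [Module.Basis.constr_basis, LinearMap.comp_apply, Submodule.subtype_apply,
    Module.Basis.span_apply] at h2
  rw [QuadraticMap.polar_comm, h1, h2]

lemma polar_sum_right (q : QuadraticForm F V) {ι : Type} (s : Finset ι) (x : V) (y : ι → V) :
    polar q x (∑ i ∈ s, y i) = ∑ i ∈ s, polar q x (y i) :=
  map_sum (polarBilin q x) y s

lemma polar_sum_left (q : QuadraticForm F V) {ι : Type} (s : Finset ι) (x : V) (y : ι → V) :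
    polar q (∑ i ∈ s, y i) x = ∑ i ∈ s, polar q (y i) x := by
  simp_rw [QuadraticMap.polar_comm q _ x, polar_sum_right]

lemma polar_self_eq_zero [CharP F 2] (q : QuadraticForm F V) (x : V) : polar q x x = 0 := by
  rw [QuadraticMap.polar_self, two_nsmul, CharTwo.add_self_eq_zero]

/-- A basis of a totally isotropic subspace extends to a family of hyperbolic pairs. -/
lemma Nonsingular.exists_dual_isotropic [CharP F 2] [FiniteDimensional F V]
    {q : QuadraticForm F V} (hq : Nonsingular F q) {m : ℕ} {e : Fin m → V}
    (he : LinearIndependent F e) (hqe : ∀ i, q (e i) = 0) (hee : ∀ i j, polar q (e i) (e j) = 0) :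
    ∃ f : Fin m → V, (∀ i, q (f i) = 0) ∧ (∀ i j, polar q (f i) (f j) = 0) ∧
      ∀ i j, polar q (e i) (f j) = if i = j then 1 else 0 := by
  choose f hf using fun j => hq.exists_polar_eq he fun i => if i = j then 1 else 0
  let T : Fin m → Fin m → F := fun i j =>
    if i < j then polar q (f i) (f j) else if i = j then q (f j) else 0
  let z : Fin m → V := fun j => ∑ i, T i j • e i
  have hez : ∀ i j, polar q (e i) (z j) = 0 := fun i j => by
    simp [z, polar_sum_right, QuadraticMap.polar_smul_right, hee]
  have hzz : ∀ i j, polar q (z i) (z j) = 0 := fun i j => by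
    rw [polar_sum_left]
    simp [QuadraticMap.polar_smul_left, hez]
  have hqz : ∀ j, q (z j) = 0 := fun j => by
    refine eq_zero_of_mem_span_of_isotropic (S := Set.range e) ?_ ?_
      (Submodule.sum_mem _ fun i _ => Submodule.smul_mem _ _ (Submodule.subset_span ⟨i, rfl⟩))
    · rintro _ ⟨i, rfl⟩
      exact hqe i
    · rintro _ ⟨i, rfl⟩ _ ⟨j, rfl⟩
      exact hee i j
  have hzf : ∀ i j, polar q (z i) (f j) = T j i := fun i j => by
    rw [polar_sum_left]
    simp [QuadraticMap.polar_smul_left, hf]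
  have hfz : ∀ i j, polar q (f i) (z j) = T i j := fun i j => by
    rw [QuadraticMap.polar_comm, hzf]
  refine ⟨fun j => f j + z j, fun j => ?_, fun i j => ?_, fun i j => ?_⟩
  · rw [QuadraticMap.map_add q, hqz, hfz]
    simp [T, CharTwo.add_self_eq_zero]
  · rw [QuadraticMap.polar_add_left, QuadraticMap.polar_add_right, QuadraticMap.polar_add_right,
      hzz, hfz, hzf]
    rcases lt_trichotomy i j with h | h | h
    · simp [T, h, h.not_gt, h.ne', CharTwo.add_self_eq_zero]
    · subst h
      rw [polar_self_eq_zero, add_zero, zero_add, CharTwo.add_self_eq_zero]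
    · simp [T, h, h.not_gt, h.ne', QuadraticMap.polar_comm q (f i), CharTwo.add_self_eq_zero]
  · rw [QuadraticMap.polar_add_right, hez, hf, add_zero]

/-- The orthogonal sum of `m` hyperbolic planes. -/
noncomputable abbrev hyperbolicQF (F : Type) [Field F] (m : ℕ) : QF F (m * 2) :=
  oSumFam F fun _ : Fin m => binQF F 0 0

lemma toQuadraticForm'_apply {n : ℕ} (M : Matrix (Fin n) (Fin n) F) (x : Fin n → F) :
    M.toQuadraticForm' x = ∑ i, ∑ j, x i * x j * M i j := by
  rw [Matrix.toQuadraticForm', LinearMap.BilinMap.toQuadraticMap_apply,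
    Matrix.toLinearMap₂'_apply]
  simp [mul_assoc]

lemma binQF_apply (a b : F) (x : Fin 2 → F) :
    binQF F a b x = a * x 0 ^ 2 + x 0 * x 1 + b * x 1 ^ 2 := by
  change Matrix.toQuadraticForm' _ x = _
  rw [toQuadraticForm'_apply]
  simp [Fin.sum_univ_two]
  ring

/-- The vector of `hyperbolicQF F m` with the given two families of coordinates. -/
def hyperbolicEquiv (F : Type) [Field F] (m : ℕ) :
    ((Fin m → F) × (Fin m → F)) ≃ₗ[F] (Fin (m * 2) → F) where
  toFun p k := ![p.1, p.2] (finProdFinEquiv.symm k).2 (finProdFinEquiv.symm k).1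
  invFun x := (fun i => x (finProdFinEquiv (i, 0)), fun i => x (finProdFinEquiv (i, 1)))
  map_add' p p' := by
    ext k
    simp only [Pi.add_apply]
    generalize (finProdFinEquiv.symm k).2 = j
    fin_cases j <;> rfl
  map_smul' c p := by
    ext k
    simp only [Pi.smul_apply]
    generalize (finProdFinEquiv.symm k).2 = j
    fin_cases j <;> rfl
  left_inv p := by
    simp only [Equiv.symm_apply_apply]
    rfl
  right_inv x := by
    ext k
    obtain ⟨⟨i, j⟩, rfl⟩ := finProdFinEquiv.surjective k
    simp only [Equiv.symm_apply_apply]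
    fin_cases j <;> rfl

lemma hyperbolicQF_equiv (m : ℕ) (p : (Fin m → F) × (Fin m → F)) :
    hyperbolicQF F m (hyperbolicEquiv F m p) = ∑ i, p.1 i * p.2 i := by
  have h : ∀ i j, hyperbolicEquiv F m p (finProdFinEquiv (i, j)) = ![p.1, p.2] j i := fun i j => by
    simp only [hyperbolicEquiv, LinearEquiv.coe_mk, LinearMap.coe_mk, AddHom.coe_mk,
      Equiv.symm_apply_apply]
  change QuadraticMap.pi (fun _ : Fin m => binQF F 0 0)
    (fun i j => hyperbolicEquiv F m p (finProdFinEquiv (i, j))) = _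
  simp only [QuadraticMap.pi_apply, binQF_apply, h]
  simp

lemma metabolic_hyperbolicQF (m : ℕ) : Metabolic (hyperbolicQF F m) := by
  refine Metabolic.of_injective ((hyperbolicEquiv F m).toLinearMap ∘ₗ LinearMap.inl F _ _)
    ((hyperbolicEquiv F m).injective.comp LinearMap.inl_injective) (fun u => ?_) ?_
  · rw [LinearMap.comp_apply, LinearEquiv.coe_coe, hyperbolicQF_equiv]
    simp
  · simp [mul_comm]

/-- A totally isotropic subspace splits off a hyperbolic form. -/
theorem Nonsingular.exists_hyperbolic_splitting [CharP F 2] [FiniteDimensional F V]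
    {q : QuadraticForm F V} (hq : Nonsingular F q) {M : Submodule F V} (hM : ∀ x ∈ M, q x = 0) :
    ∃ (k : ℕ) (ρ : QF F k), k + 2 * Module.finrank F M = Module.finrank F V ∧
      ∃ f : ((Fin (Module.finrank F M * 2) → F) × (Fin k → F)) ≃ₗ[F] V,
        ∀ x, q (f x) = (hyperbolicQF F (Module.finrank F M)).prod ρ x := by
  set m := Module.finrank F M
  let bM := Module.finBasis F M
  let e : Fin m → V := fun i => bM i
  have he : LinearIndependent F e := bM.linearIndependent.map' M.subtype M.ker_subtype
  have hqe : ∀ i, q (e i) = 0 := fun i => hM _ (bM i).2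
  have hee : ∀ i j, polar q (e i) (e j) = 0 := fun i j =>
    polar_eq_zero_of_isotropic hM (bM i).2 (bM j).2
  obtain ⟨f, hqf, hff, hef⟩ := hq.exists_dual_isotropic he hqe hee
  let J : ((Fin m → F) × (Fin m → F)) →ₗ[F] V :=
    (Fintype.linearCombination F e).coprod (Fintype.linearCombination F f)
  have hJ : ∀ p, J p = ∑ i, p.1 i • e i + ∑ i, p.2 i • f i := fun p => by
    simp [J, Fintype.linearCombination_apply]
  let T : V →ₗ[F] (Fin m → F) × (Fin m → F) :=
    (LinearMap.pi fun i => polarBilin q (f i)).prod (LinearMap.pi fun i => polarBilin q (e i))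
  have hT : ∀ v, T v = (fun i => polar q (f i) v, fun i => polar q (e i) v) := fun v => rfl
  have hTJ : ∀ p, T (J p) = p := fun p => by
    rw [hT, hJ]
    refine Prod.ext (funext fun i => ?_) (funext fun i => ?_)
    · simp [QuadraticMap.polar_add_right, polar_sum_right, QuadraticMap.polar_smul_right, hff,
        QuadraticMap.polar_comm q (f i) (e _), hef]
    · simp [QuadraticMap.polar_add_right, polar_sum_right, QuadraticMap.polar_smul_right, hee,
        hef]
  have hqJ : ∀ p, q (J p) = ∑ i, p.1 i * p.2 i := fun p => by
    have h1 : q (∑ i, p.1 i • e i) = 0 := by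
      refine eq_zero_of_mem_span_of_isotropic (S := Set.range e) ?_ ?_
        (Submodule.sum_mem _ fun i _ => Submodule.smul_mem _ _ (Submodule.subset_span ⟨i, rfl⟩))
      · rintro _ ⟨i, rfl⟩
        exact hqe i
      · rintro _ ⟨i, rfl⟩ _ ⟨j, rfl⟩
        exact hee i j
    have h2 : q (∑ i, p.2 i • f i) = 0 := by
      refine eq_zero_of_mem_span_of_isotropic (S := Set.range f) ?_ ?_
        (Submodule.sum_mem _ fun i _ => Submodule.smul_mem _ _ (Submodule.subset_span ⟨i, rfl⟩))
      · rintro _ ⟨i, rfl⟩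
        exact hqf i
      · rintro _ ⟨i, rfl⟩ _ ⟨j, rfl⟩
        exact hff i j
    rw [hJ, QuadraticMap.map_add q, h1, h2]
    simp [polar_sum_left, polar_sum_right, QuadraticMap.polar_smul_left,
      QuadraticMap.polar_smul_right, hef, mul_comm]
  let C : Submodule F V := LinearMap.ker T
  have hJC : ∀ p, ∀ c ∈ C, polar q (J p) c = 0 := fun p c hc => by
    have hc' := LinearMap.mem_ker.1 hc
    rw [hT] at hc'
    have h1 : ∀ i, polar q (f i) c = 0 := fun i => congrFun (Prod.ext_iff.1 hc').1 i
    have h2 : ∀ i, polar q (e i) c = 0 := fun i => congrFun (Prod.ext_iff.1 hc').2 i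
    simp [hJ, QuadraticMap.polar_add_left, polar_sum_left, QuadraticMap.polar_smul_left, h1, h2]
  let g : (((Fin m → F) × (Fin m → F)) × C) →ₗ[F] V := J.coprod C.subtype
  have hg : ∀ x, g x = J x.1 + x.2 := fun x => by simp [g]
  have hgb : Function.Bijective g := by
    constructor
    · rw [injective_iff_map_eq_zero]
      intro x hx
      have h1 := congrArg T hx
      have h2 : T (x.2 : V) = 0 := LinearMap.mem_ker.1 x.2.2
      rw [hg, map_add, hTJ, h2, add_zero, map_zero] at h1
      rw [hg, h1, map_zero, zero_add] at hx
      exact Prod.ext h1 (Subtype.ext hx)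
    · intro v
      refine ⟨(T v, ⟨v - J (T v), ?_⟩), by simp [hg]⟩
      rw [LinearMap.mem_ker, map_sub, hTJ, sub_self]
  let bC := (Module.finBasis F C).equivFun
  let f' : ((Fin (m * 2) → F) × (Fin (Module.finrank F C) → F)) ≃ₗ[F] V :=
    ((hyperbolicEquiv F m).symm.prodCongr bC.symm).trans (LinearEquiv.ofBijective g hgb)
  refine ⟨Module.finrank F C, (q.restrict C).comp bC.symm.toLinearMap, ?_, f', ?_⟩
  · rw [← f'.finrank_eq]
    simp [mul_comm, add_comm]
  · rintro ⟨x, y⟩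
    obtain ⟨x, rfl⟩ := (hyperbolicEquiv F m).surjective x
    have h1 : f' (hyperbolicEquiv F m x, y) = J x + (bC.symm y : V) := by
      simp [f', LinearEquiv.ofBijective_apply, hg]
    rw [h1, QuadraticMap.map_add q, hJC x _ (bC.symm y).2, hqJ, QuadraticMap.prod_apply,
      hyperbolicQF_equiv, add_zero]
    rfl

end WittDecomposition

section WittEquivalence

variable {F}
variable {V V₁ V₂ V₃ V₄ : Type} [AddCommGroup V] [Module F V]
  [AddCommGroup V₃] [Module F V₃] [AddCommGroup V₄] [Module F V₄]
  [AddCommGroup V₁] [Module F V₁] [AddCommGroup V₂] [Module F V₂]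

lemma oSum_equivalent {n m : ℕ} (q₁ : QF F n) (q₂ : QF F m) :
    (q₁.prod q₂).Equivalent (oSum F q₁ q₂) :=
  ⟨isometryEquivOfCompLinearEquiv (q₁.prod q₂)
    ((LinearEquiv.funCongrLeft F F finSumFinEquiv).trans
      (LinearEquiv.sumArrowLequivProdArrow (Fin n) (Fin m) F F))⟩

lemma equivalent_prod_zero (q : QuadraticForm F V) : q.Equivalent (q.prod (0 : QF F 0)) :=
  ⟨{ toLinearEquiv := LinearEquiv.ofBijective (LinearMap.inl F V (Fin 0 → F))
      ⟨LinearMap.inl_injective, fun x => ⟨x.1, Prod.ext rfl (Subsingleton.elim _ _)⟩⟩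
     map_app' := fun x => by
      change q.prod (0 : QF F 0) (x, 0) = q x
      simp }⟩

lemma Metabolic.of_equivalent [FiniteDimensional F V₁] {q₁ : QuadraticForm F V₁}
    {q₂ : QuadraticForm F V₂} (h : Metabolic q₁) (e : q₁.Equivalent q₂) : Metabolic q₂ :=
  e.elim fun f => h.of_isometry f.toLinearEquiv f.map_app

lemma Metabolic.prodProdProdComm [FiniteDimensional F V₁] [FiniteDimensional F V₂]
    [FiniteDimensional F V₃] [FiniteDimensional F V₄] {q₁ : QuadraticForm F V₁}
    {q₂ : QuadraticForm F V₂} {q₃ : QuadraticForm F V₃} {q₄ : QuadraticForm F V₄}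
    (h : Metabolic ((q₁.prod q₂).prod (q₃.prod q₄))) :
    Metabolic ((q₁.prod q₃).prod (q₂.prod q₄)) :=
  h.of_isometry (LinearEquiv.prodProdProdComm F V₁ V₂ V₃ V₄) fun _ => add_add_add_comm _ _ _ _

lemma metabolic_prodAssoc_iff [FiniteDimensional F V₁] [FiniteDimensional F V₂]
    [FiniteDimensional F V₃] {q₁ : QuadraticForm F V₁} {q₂ : QuadraticForm F V₂}
    {q₃ : QuadraticForm F V₃} :
    Metabolic ((q₁.prod q₂).prod q₃) ↔ Metabolic (q₁.prod (q₂.prod q₃)) :=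
  ⟨fun h => h.of_isometry (LinearEquiv.prodAssoc F V₁ V₂ V₃) fun _ => (add_assoc _ _ _).symm,
    fun h => h.of_isometry (LinearEquiv.prodAssoc F V₁ V₂ V₃).symm fun _ => add_assoc _ _ _⟩

lemma Nonsingular.of_equivalent {q₁ : QuadraticForm F V₁} {q₂ : QuadraticForm F V₂}
    (h : Nonsingular F q₁) (e : q₁.Equivalent q₂) : Nonsingular F q₂ := by
  obtain ⟨f⟩ := e
  intro x hx
  have hp : ∀ u v, polar q₂ (f u) (f v) = polar q₁ u v := fun u v => by
    have h1 : f (u + v) = f u + f v := map_add f.toLinearEquiv u v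
    simp only [polar, ← h1, f.map_app]
  obtain ⟨u, rfl⟩ := f.toLinearEquiv.surjective x
  rw [h u fun v => by rw [← hp]; exact hx _, map_zero]

lemma Nonsingular.prod {q₁ : QuadraticForm F V₁} {q₂ : QuadraticForm F V₂}
    (h₁ : Nonsingular F q₁) (h₂ : Nonsingular F q₂) : Nonsingular F (q₁.prod q₂) := by
  intro x hx
  refine Prod.ext (h₁ _ fun y => ?_) (h₂ _ fun y => ?_)
  · simpa using hx (y, 0)
  · simpa using hx (0, y)

lemma Nonsingular.of_prod_left {q₁ : QuadraticForm F V₁} {q₂ : QuadraticForm F V₂}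
    (h : Nonsingular F (q₁.prod q₂)) : Nonsingular F q₁ := fun x hx =>
  (Prod.ext_iff.1 (h (x, 0) fun y => by simpa using hx y.1)).1

lemma Nonsingular.of_prod_right {q₁ : QuadraticForm F V₁} {q₂ : QuadraticForm F V₂}
    (h : Nonsingular F (q₁.prod q₂)) : Nonsingular F q₂ := fun x hx =>
  (Prod.ext_iff.1 (h (0, x) fun y => by simpa using hx y.2)).2

lemma Nonsingular.smul {q : QuadraticForm F V} (h : Nonsingular F q) {c : F} (hc : c ≠ 0) :
    Nonsingular F (c • q) := fun x hx => h x fun y => by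
  have := hx y
  rw [FunLike.coe_smul, QuadraticMap.polar_smul] at this
  exact (smul_eq_zero.1 this).resolve_left hc

lemma Nonsingular.oSum {n m : ℕ} {q₁ : QF F n} {q₂ : QF F m}
    (h₁ : Nonsingular F q₁) (h₂ : Nonsingular F q₂) : Nonsingular F (oSum F q₁ q₂) :=
  (h₁.prod h₂).of_equivalent (oSum_equivalent q₁ q₂)

/-- Every nonsingular form is the sum of a hyperbolic form and an anisotropic one. -/
theorem Nonsingular.exists_anisotropic_part [CharP F 2] [FiniteDimensional F V]
    {q : QuadraticForm F V} (hq : Nonsingular F q) :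
    ∃ (i r : ℕ) (ρ : QF F r), ρ.Anisotropic ∧ ((hyperbolicQF F i).prod ρ).Equivalent q := by
  let P : ℕ → Prop := fun m =>
    ∃ M : Submodule F V, (∀ x ∈ M, q x = 0) ∧ Module.finrank F M = m
  have hP0 : P 0 := ⟨⊥, fun x hx => by rw [(Submodule.mem_bot F).1 hx, QuadraticMap.map_zero],
    finrank_bot F V⟩
  classical
  obtain ⟨M, hM, hd⟩ := Nat.findGreatest_spec (P := P) (Nat.zero_le (Module.finrank F V)) hP0
  obtain ⟨k, ρ, -, f, hf⟩ := hq.exists_hyperbolic_splitting hM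
  refine ⟨_, k, ρ, ?_, ⟨⟨f, hf⟩⟩⟩
  intro x hx
  by_contra hx0
  obtain ⟨L, hL, hLd⟩ := metabolic_hyperbolicQF (F := F) (Module.finrank F M)
  let g : (L × F) →ₗ[F] V := f.toLinearMap ∘ₗ L.subtype.prodMap (LinearMap.toSpanSingleton F _ x)
  have hg : Function.Injective g := f.injective.comp
    (Function.Injective.prodMap L.injective_subtype (smul_left_injective F hx0))
  have hgq : ∀ u, q (g u) = 0 := fun u => by
    change q (f ((u.1 : _), u.2 • x)) = 0
    rw [hf, QuadraticMap.prod_apply, hL _ u.1.2, QuadraticMap.map_smul, hx, smul_zero, add_zero]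
  have hgd : Module.finrank F (LinearMap.range g) = Module.finrank F L + 1 := by
    rw [LinearMap.finrank_range_of_inj hg, Module.finrank_prod, Module.finrank_self]
  have hle := Nat.le_findGreatest (P := P) (m := Module.finrank F L + 1)
    (n := Module.finrank F V) (hgd ▸ Submodule.finrank_le _)
    ⟨LinearMap.range g, by rintro _ ⟨u, rfl⟩; exact hgq u, hgd⟩
  rw [Module.finrank_fin_fun] at hLd
  omega

lemma equivalent_of_metabolic_prod [CharP F 2] [FiniteDimensional F V₁] [FiniteDimensional F V₂]
    {q₁ : QuadraticForm F V₁} {q₂ : QuadraticForm F V₂} (h₁ : q₁.Anisotropic)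
    (h₂ : q₂.Anisotropic) (h : Metabolic (q₁.prod q₂)) : q₁.Equivalent q₂ := by
  obtain ⟨L, hL, hd⟩ := h
  have hLq : ∀ x : L, q₁ x.1.1 = q₂ x.1.2 := fun x =>
    CharTwo.add_eq_zero.1 (hL _ x.2)
  let a : L →ₗ[F] V₁ := LinearMap.fst F V₁ V₂ ∘ₗ L.subtype
  let b : L →ₗ[F] V₂ := LinearMap.snd F V₁ V₂ ∘ₗ L.subtype
  have ha : Function.Injective a := by
    rw [injective_iff_map_eq_zero]
    intro x hx
    change x.1.1 = 0 at hx
    have h3 := hLq x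
    rw [hx, QuadraticMap.map_zero] at h3
    exact Subtype.ext (Prod.ext hx (h₂ _ h3.symm))
  have hb : Function.Injective b := by
    rw [injective_iff_map_eq_zero]
    intro x hx
    change x.1.2 = 0 at hx
    have h3 := hLq x
    rw [hx, QuadraticMap.map_zero] at h3
    exact Subtype.ext (Prod.ext (h₁ _ h3) hx)
  have hda := LinearMap.finrank_le_finrank_of_injective ha
  have hdb := LinearMap.finrank_le_finrank_of_injective hb
  rw [Module.finrank_prod] at hd
  let a' := LinearEquiv.ofInjectiveOfFinrankEq a ha (by omega)
  let b' := LinearEquiv.ofInjectiveOfFinrankEq b hb (by omega)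
  refine ⟨⟨a'.symm.trans b', fun x => ?_⟩⟩
  obtain ⟨x, rfl⟩ := a'.surjective x
  change q₂ (b' (a'.symm (a' x))) = q₁ (a' x)
  rw [a'.symm_apply_apply]
  exact (hLq x).symm

theorem WittEquiv.metabolic [CharP F 2] {q₁ : QuadraticForm F V₁}
    {q₂ : QuadraticForm F V₂} (h : WittEquiv F q₁ q₂) : Metabolic (q₁.prod q₂) := by
  obtain ⟨r, ρ, -, ⟨i, j, h₁⟩, i', j', h₂⟩ := h
  have aux : ∀ i j : ℕ, (((hyperbolicQF F i).prod ρ).prod (diagQF F (0 : Fin j → F))).Equivalent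
      (oSum F (oSum F (hyperbolicQF F i) ρ) (diagQF F (0 : Fin j → F))) := fun i j =>
    ((oSum_equivalent _ _).prod (.refl _)).trans (oSum_equivalent _ _)
  have hz : ∀ j : ℕ, Metabolic (diagQF F (0 : Fin j → F)) := fun j =>
    ⟨⊤, fun x _ => by simp [diagQF], by rw [finrank_top]; omega⟩
  refine Metabolic.of_equivalent ?_
    (((aux i j).trans (Equivalent.symm h₁)).prod ((aux i' j').trans (Equivalent.symm h₂)))
  refine Metabolic.prodProdProdComm (Metabolic.prod ?_ ((hz j).prod (hz j')))
  exact (((metabolic_hyperbolicQF i).prod (metabolic_hyperbolicQF i')).prod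
    (metabolic_prod_self ρ)).prodProdProdComm

theorem wittEquiv_of_metabolic [CharP F 2] [FiniteDimensional F V₁] [FiniteDimensional F V₂]
    {q₁ : QuadraticForm F V₁} {q₂ : QuadraticForm F V₂} (hq₁ : Nonsingular F q₁)
    (hq₂ : Nonsingular F q₂) (h : Metabolic (q₁.prod q₂)) : WittEquiv F q₁ q₂ := by
  obtain ⟨i₁, r₁, ρ₁, h₁, e₁⟩ := hq₁.exists_anisotropic_part
  obtain ⟨i₂, r₂, ρ₂, h₂, e₂⟩ := hq₂.exists_anisotropic_part
  have hn₁ := hq₁.of_equivalent e₁.symm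
  have hn₂ := hq₂.of_equivalent e₂.symm
  have h3 : Metabolic (((hyperbolicQF F i₁).prod ρ₁).prod ((hyperbolicQF F i₂).prod ρ₂)) :=
    h.of_equivalent (e₁.symm.prod e₂.symm)
  have h4 := equivalent_of_metabolic_prod h₁ h₂ (h3.prodProdProdComm.swap.cancel
    (hn₁.of_prod_left.prod hn₂.of_prod_left)
    ((metabolic_hyperbolicQF i₁).prod (metabolic_hyperbolicQF i₂)))
  have aux : ∀ i : ℕ, ((hyperbolicQF F i).prod ρ₁).Equivalent
      (oSum F (oSum F (hyperbolicQF F i) ρ₁) (diagQF F (0 : Fin 0 → F))) := fun i => by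
    have h0 : diagQF F (0 : Fin 0 → F) = 0 := by
      ext x
      simp [diagQF]
    rw [h0]
    exact ((oSum_equivalent _ _).trans (equivalent_prod_zero _)).trans (oSum_equivalent _ _)
  exact ⟨r₁, ρ₁, h₁, ⟨i₁, 0, e₁.symm.trans (aux i₁)⟩,
    i₂, 0, (e₂.symm.trans ((Equivalent.refl _).prod h4.symm)).trans (aux i₂)⟩

end WittEquivalence

section ScalarExtension

variable {F}
variable {E : Type} [Field E] [Algebra F E]

lemma quadraticForm_eq_of_span {V : Type} [AddCommGroup V] [Module F V]
    {q₁ q₂ : QuadraticForm F V} {S : Set V} (hS : Submodule.span F S = ⊤)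
    (h : ∀ x ∈ S, q₁ x = q₂ x) (h' : ∀ x ∈ S, ∀ y ∈ S, polar q₁ x y = polar q₂ x y) :
    q₁ = q₂ := by
  ext x
  have h0 : (q₁ - q₂) x = 0 := by
    refine eq_zero_of_mem_span_of_isotropic (S := S) (fun x hx => ?_) (fun x hx y hy => ?_)
      (hS ▸ Submodule.mem_top)
    · rw [sub_apply, h x hx, sub_self]
    · have := h' x hx y hy
      simp only [polar] at this
      simp only [polar, sub_apply]
      linear_combination this
  exact sub_eq_zero.1 h0

lemma span_range_algebraMap (n : ℕ) :
    Submodule.span E (Set.range (Pi.algebraMap (Fin n) F E)) = ⊤ := by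
  rw [eq_top_iff, ← (Pi.basisFun E (Fin n)).span_eq]
  refine Submodule.span_mono ?_
  rintro _ ⟨i, rfl⟩
  refine ⟨Pi.single i 1, ?_⟩
  ext j
  by_cases h : j = i
  · subst h
    simp [Pi.algebraMap]
  · simp [Pi.algebraMap, h]

lemma toQuadraticForm'_qMat {n : ℕ} (q : QF F n) : (qMat F q).toQuadraticForm' = q := by
  have hs : ∀ i j, Matrix.toLinearMap₂' F (qMat F q) (Pi.single i (1 : F)) (Pi.single j (1 : F)) =
      qMat F q i j := fun i j => by
    simp [Matrix.toLinearMap₂'_apply, Pi.single_apply]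
  refine quadraticForm_eq_of_span (Pi.basisFun F (Fin n)).span_eq ?_ ?_
  · rintro _ ⟨i, rfl⟩
    rw [Pi.basisFun_apply, Matrix.toQuadraticForm', LinearMap.BilinMap.toQuadraticMap_apply]
    refine (hs i i).trans ?_
    simp [qMat]
  · rintro _ ⟨i, rfl⟩ _ ⟨j, rfl⟩
    rw [Matrix.toQuadraticForm', LinearMap.BilinMap.polar_toQuadraticMap, Pi.basisFun_apply,
      Pi.basisFun_apply]
    refine (congrArg₂ (· + ·) (hs i j) (hs j i)).trans ?_
    rcases lt_trichotomy i j with h | h | h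
    · simp [qMat, h.ne, h.ne', h, h.not_gt]
    · subst h
      simp [qMat, QuadraticMap.polar_self, two_mul]
    · simp [qMat, h.ne, h.ne', h, h.not_gt, QuadraticMap.polar_comm q (Pi.single i (1 : F))]

lemma extQF_algebraMap {n : ℕ} (q : QF F n) (v : Fin n → F) :
    extQF F E q (Pi.algebraMap (Fin n) F E v) = algebraMap F E (q v) := by
  conv_rhs => rw [← toQuadraticForm'_qMat q]
  change Matrix.toQuadraticForm' _ _ = _
  simp [toQuadraticForm'_apply, Pi.algebraMap]

lemma polar_extQF_algebraMap {n : ℕ} (q : QF F n) (v w : Fin n → F) :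
    polar (extQF F E q) (Pi.algebraMap (Fin n) F E v) (Pi.algebraMap (Fin n) F E w) =
      algebraMap F E (polar q v w) := by
  simp only [polar, ← map_add (Pi.algebraMap (Fin n) F E), extQF_algebraMap (E := E), ← map_sub]

lemma extQF_eq {n : ℕ} {q : QF F n} {Q : QF E n}
    (h : ∀ v, Q (Pi.algebraMap (Fin n) F E v) = algebraMap F E (q v)) : extQF F E q = Q := by
  refine quadraticForm_eq_of_span (span_range_algebraMap (F := F) n) ?_ ?_
  · rintro _ ⟨v, rfl⟩
    rw [h, extQF_algebraMap]
  · rintro _ ⟨v, rfl⟩ _ ⟨w, rfl⟩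
    rw [polar_extQF_algebraMap]
    simp only [polar, ← map_add (Pi.algebraMap (Fin n) F E), h, ← map_sub]

lemma oSum_apply {n m : ℕ} (q₁ : QF F n) (q₂ : QF F m) (x : Fin (n + m) → F) :
    oSum F q₁ q₂ x = q₁ (fun i => x (Fin.castAdd m i)) + q₂ (fun j => x (Fin.natAdd n j)) :=
  rfl

lemma extQF_oSum {n m : ℕ} (q₁ : QF F n) (q₂ : QF F m) :
    extQF F E (oSum F q₁ q₂) = oSum E (extQF F E q₁) (extQF F E q₂) :=
  extQF_eq fun v => by
    rw [oSum_apply, oSum_apply, map_add, ← extQF_algebraMap, ← extQF_algebraMap]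
    rfl

lemma extQF_smul {n : ℕ} (c : F) (q : QF F n) :
    extQF F E (c • q) = algebraMap F E c • extQF F E q :=
  extQF_eq fun v => by simp [extQF_algebraMap, Algebra.smul_def]

lemma extQF_binQF (a b : F) :
    extQF F E (binQF F a b) = binQF E (algebraMap F E a) (algebraMap F E b) :=
  extQF_eq fun v => by simp [binQF_apply, Pi.algebraMap]

lemma extQF_pf2 (g h : F) :
    extQF F E (pf2 F g h) = pf2 E (algebraMap F E g) (algebraMap F E h) := by
  rw [pf2, extQF_oSum, extQF_smul, extQF_binQF, map_one, pf2]

lemma extQF_pf3 (g₁ g₂ h : F) : extQF F E (pf3 F g₁ g₂ h) =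
    pf3 E (algebraMap F E g₁) (algebraMap F E g₂) (algebraMap F E h) := by
  rw [pf3, extQF_oSum, extQF_smul, extQF_pf2, pf3]

lemma pf2_apply (g h : F) (x : Fin 4 → F) : pf2 F g h x =
    x 0 ^ 2 + x 0 * x 1 + h * x 1 ^ 2 + g * (x 2 ^ 2 + x 2 * x 3 + h * x 3 ^ 2) := by
  rw [pf2, oSum_apply, smul_apply, binQF_apply, binQF_apply, one_mul, one_mul]
  rfl

lemma pf3_apply (g₁ g₂ h : F) (x : Fin 8 → F) : pf3 F g₁ g₂ h x =
    x 0 ^ 2 + x 0 * x 1 + h * x 1 ^ 2 + g₂ * (x 2 ^ 2 + x 2 * x 3 + h * x 3 ^ 2) +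
    g₁ * (x 4 ^ 2 + x 4 * x 5 + h * x 5 ^ 2 + g₂ * (x 6 ^ 2 + x 6 * x 7 + h * x 7 ^ 2)) := by
  rw [pf3, oSum_apply, smul_apply, pf2_apply, pf2_apply]
  rfl

lemma nonsingular_binQF [CharP F 2] (a b : F) : Nonsingular F (binQF F a b) := by
  intro x hx
  have h : ∀ y, polar (binQF F a b) x y = x 0 * y 1 + y 0 * x 1 := fun y => by
    simp only [polar, binQF_apply, Pi.add_apply]
    linear_combination (a * x 0 * y 0 + b * x 1 * y 1) * CharTwo.two_eq_zero (R := F)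
  have h0 := (h ![1, 0]).symm.trans (hx _)
  have h1 := (h ![0, 1]).symm.trans (hx _)
  ext i
  fin_cases i
  · simpa using h1
  · simpa using h0

lemma nonsingular_pf2 [CharP F 2] {g : F} (hg : g ≠ 0) (h : F) : Nonsingular F (pf2 F g h) :=
  (nonsingular_binQF 1 h).oSum ((nonsingular_binQF 1 h).smul hg)

lemma nonsingular_pf3 [CharP F 2] {g₁ g₂ : F} (hg₁ : g₁ ≠ 0) (hg₂ : g₂ ≠ 0) (h : F) :
    Nonsingular F (pf3 F g₁ g₂ h) :=
  (nonsingular_pf2 hg₂ h).oSum ((nonsingular_pf2 hg₂ h).smul hg₁)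

lemma Nonsingular.extQF {n : ℕ} {q : QF F n} (hq : Nonsingular F q) :
    Nonsingular E (extQF F E q) := by
  intro x hx
  let e := Pi.basisFun F (Fin n)
  choose f hf using fun j => hq.exists_polar_eq e.linearIndependent
    fun i => if i = j then (1 : F) else 0
  have h1 : x = ∑ i, x i • Pi.algebraMap (Fin n) F E (e i) := by
    ext j
    simp [e, Pi.algebraMap, Pi.single_apply, apply_ite (algebraMap F E)]
  ext j
  have h2 := hx (Pi.algebraMap (Fin n) F E (f j))
  rw [h1, polar_sum_left] at h2
  simpa [QuadraticMap.polar_smul_left, polar_extQF_algebraMap, hf,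
    apply_ite (algebraMap F E)] using h2

lemma Metabolic.extQF {n : ℕ} {q : QF F n} (hq : Metabolic q) : Metabolic (extQF F E q) := by
  obtain ⟨L, hL, hd⟩ := hq
  let bL := Module.finBasis F L
  let e : Fin (Module.finrank F L) → Fin n → F := fun i => bL i
  have he : LinearIndependent F e := bL.linearIndependent.map' L.subtype L.ker_subtype
  have he' : LinearIndependent E fun i => Pi.algebraMap (Fin n) F E (e i) :=
    linearIndependent_algebraMap_comp_iff.2 he
  refine ⟨Submodule.span E (Set.range fun i => Pi.algebraMap (Fin n) F E (e i)), fun x hx => ?_, ?_⟩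
  · refine eq_zero_of_mem_span_of_isotropic ?_ ?_ hx
    · rintro _ ⟨i, rfl⟩
      rw [extQF_algebraMap, hL _ (bL i).2, map_zero]
    · rintro _ ⟨i, rfl⟩ _ ⟨j, rfl⟩
      rw [polar_extQF_algebraMap, polar_eq_zero_of_isotropic hL (bL i).2 (bL j).2, map_zero]
  · rw [finrank_span_eq_card he']
    simpa using hd

lemma Metabolic.extQF_prod {n m : ℕ} {q₁ : QF F n} {q₂ : QF F m} (h : Metabolic (q₁.prod q₂)) :
    Metabolic ((_root_.extQF F E q₁).prod (_root_.extQF F E q₂)) := by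
  have h1 := (h.of_equivalent (oSum_equivalent q₁ q₂)).extQF (E := E)
  rw [extQF_oSum] at h1
  exact h1.of_equivalent (oSum_equivalent _ _).symm

lemma inWqKernel_iff_metabolic [CharP F 2] {n : ℕ} {q : QF F n} (hq : Nonsingular F q) :
    InWqKernel F E q ↔ Metabolic (_root_.extQF F E q) := by
  have : CharP E 2 := charP_of_injective_algebraMap (algebraMap F E).injective 2
  have h0 : Nonsingular E (0 : QF E 0) := fun x _ => Subsingleton.elim _ _
  exact ⟨fun h => (WittEquiv.metabolic h).cancel h0 ⟨⊤, fun _ _ => rfl, by simp⟩,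
    fun h => wittEquiv_of_metabolic hq.extQF h0 (metabolic_prod_zero h)⟩

end ScalarExtension

section Generators

variable {F}

lemma metabolic_binQF [CharP F 2] {g β : F} (hβ : β ^ 2 + β + g = 0) :
    Metabolic (binQF F 1 g) := by
  let f : F →ₗ[F] (Fin 2 → F) :=
    { toFun := fun x => ![β * x, x]
      map_add' := fun x y => by ext i; fin_cases i <;> simp [mul_add]
      map_smul' := fun c x => by ext i; fin_cases i <;> simp [mul_left_comm] }
  refine Metabolic.of_injective f (fun x y h => by simpa [f] using congrFun h 1) (fun x => ?_)
    (by simp)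
  rw [binQF_apply]
  simp only [f, LinearMap.coe_mk, AddHom.coe_mk, Matrix.cons_val_zero, Matrix.cons_val_one]
  linear_combination x ^ 2 * hβ

/-- `⟨⟨t, s]]` is metabolic as soon as `t` is represented by the norm form `[1, s]`. -/
lemma metabolic_pf2 [CharP F 2] {t s p r : F} (ht : t = p ^ 2 + p * r + s * r ^ 2) :
    Metabolic (pf2 F t s) := by
  let f : (F × F) →ₗ[F] (Fin 4 → F) :=
    { toFun := fun x => ![p * x.1 + s * r * x.2, p * x.2 + r * x.1 + r * x.2, x.1, x.2]
      map_add' := fun x y => by ext i; fin_cases i <;> simp <;> ring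
      map_smul' := fun c x => by ext i; fin_cases i <;> simp <;> ring }
  refine Metabolic.of_injective f (fun x y h => Prod.ext ?_ ?_) (fun x => ?_) (by simp)
  · simpa [f] using congrFun h 2
  · simpa [f] using congrFun h 3
  · rw [pf2_apply]
    simp only [f, LinearMap.coe_mk, AddHom.coe_mk, Matrix.cons_val]
    grind

lemma metabolic_pf3 [CharP F 2] {b d h α : F} (hα : α ^ 4 + b * α ^ 2 + d = 0) :
    Metabolic (pf3 F b d h) := by
  let f : (Fin 4 → F) →ₗ[F] (Fin 8 → F) :=
    { toFun := fun x => ![α ^ 2 * x 0 + b * α * x 2, α ^ 2 * x 1 + b * α * x 3, x 0, x 1,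
        α * x 0 + α ^ 2 * x 2, α * x 1 + α ^ 2 * x 3, x 2, x 3]
      map_add' := fun x y => by ext i; fin_cases i <;> simp <;> ring
      map_smul' := fun c x => by ext i; fin_cases i <;> simp <;> ring }
  refine Metabolic.of_injective f (fun x y h => ?_) (fun x => ?_) (by simp)
  · have h2 := congrFun h 2
    have h3 := congrFun h 3
    have h6 := congrFun h 6
    have h7 := congrFun h 7
    simp only [f, LinearMap.coe_mk, AddHom.coe_mk, Matrix.cons_val] at h2 h3 h6 h7
    ext i
    fin_cases i <;> assumption
  · rw [pf3_apply]
    simp only [f, LinearMap.coe_mk, AddHom.coe_mk, Matrix.cons_val]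
    grind

lemma metabolic_smul {V : Type} [AddCommGroup V] [Module F V] {q : QuadraticForm F V}
    (h : Metabolic q) (c : F) : Metabolic (c • q) := by
  obtain ⟨L, hL, hd⟩ := h
  exact ⟨L, fun x hx => by rw [smul_apply, hL x hx, smul_zero], hd⟩

variable {E : Type} [Field E] [Algebra F E] {a b c d : F} {α : E}

lemma IsQuarticGen.nonsingular [CharP F 2] (hd : d ≠ 0) {x : Σ n, QF F n}
    (hx : IsQuarticGen F E a b c d (a = 0 ∧ c = 0 ∧ b ≠ 0) x) : Nonsingular F x.2 := by
  obtain ⟨g, -, rfl⟩ | ⟨g, h, hg, -, rfl⟩ | ⟨e, -, he, rfl⟩ | ⟨⟨-, -, hb⟩, h, rfl⟩ := hx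
  · exact nonsingular_binQF _ _
  · exact nonsingular_pf2 hg h
  · exact nonsingular_pf2 he _
  · exact nonsingular_pf3 hb hd h

lemma IsQuarticGen.metabolic_extQF [CharP F 2] (hd : d ≠ 0)
    (hα : α ^ 4 + algebraMap F E a * α ^ 3 + algebraMap F E b * α ^ 2
        + algebraMap F E c * α + algebraMap F E d = 0) {x : Σ n, QF F n}
    (hx : IsQuarticGen F E a b c d (a = 0 ∧ c = 0 ∧ b ≠ 0) x) :
    Metabolic (extQF F E x.2) := by
  have : CharP E 2 := charP_of_injective_algebraMap (algebraMap F E).injective 2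
  have hd' : algebraMap F E d ≠ 0 := by simpa using hd
  have hα0 : α ≠ 0 := by
    rintro rfl
    exact hd' (by simpa using hα)
  obtain ⟨g, ⟨β, hβ⟩, rfl⟩ | ⟨g, h, hg, ⟨β, hβ⟩, rfl⟩ | ⟨e, he0, he, rfl⟩ |
    ⟨⟨ha, hc, hb⟩, h, rfl⟩ := hx
  · rw [extQF_binQF, map_one]
    exact metabolic_binQF hβ
  · rw [extQF_pf2]
    exact metabolic_pf2 (p := β) (r := 0) (by rw [← hβ]; ring)
  · have he' : algebraMap F E e ≠ 0 := by simpa using he0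
    rw [extQF_pf2]
    refine metabolic_pf2 (p := algebraMap F E c + algebraMap F E e * α)
      (r := algebraMap F E a * algebraMap F E e + algebraMap F E e ^ 2 * α⁻¹) ?_
    simp only [cubicResolvent, map_add, map_mul, map_pow, map_div₀]
    generalize algebraMap F E a = a at *
    generalize algebraMap F E b = b at *
    generalize algebraMap F E c = c at *
    generalize algebraMap F E d = d at *
    generalize algebraMap F E e = e at *
    field_simp
    grind
  · rw [extQF_pf3]
    subst ha hc
    exact metabolic_pf3 (α := α) (by simpa using hα)

lemma nonsingular_listOSum {L : List (Σ n, QF F n)} (hL : ∀ x ∈ L, Nonsingular F x.2) :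
    Nonsingular F (listOSum F L).2 := by
  induction L with
  | nil =>
    change Nonsingular F (0 : QF F 0)
    exact fun x _ => Subsingleton.elim _ _
  | cons x L ih =>
    exact (hL x (by simp)).oSum (ih fun y hy => hL y (by simp [hy]))

lemma metabolic_extQF_listOSum {L : List (Σ n, QF F n)}
    (hL : ∀ x ∈ L, Metabolic (extQF F E x.2)) : Metabolic (extQF F E (listOSum F L).2) := by
  induction L with
  | nil =>
    have h : Metabolic (0 : QF F 0) := ⟨⊤, fun _ _ => rfl, by simp⟩
    exact h.extQF
  | cons x L ih =>
    change Metabolic (extQF F E (oSum F x.2 (listOSum F L).2))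
    rw [extQF_oSum]
    exact ((hL x (by simp)).prod (ih fun y hy => hL y (by simp [hy]))).of_equivalent
      (oSum_equivalent _ _)

end Generators

section Reduction

variable {F}
variable {V : Type} [AddCommGroup V] [Module F V] [FiniteDimensional F V]

/-- `q` is, up to adding `τ`, Witt equivalent to a nonsingular form of smaller dimension. -/
def ReducesBy (q : QuadraticForm F V) {t : ℕ} (τ : QF F t) : Prop :=
  ∃ n < Module.finrank F V, ∃ q' : QF F n, Nonsingular F q' ∧ Metabolic ((q.prod τ).prod q')

variable [CharP F 2]

lemma Nonsingular.reducesBy {q : QuadraticForm F V} (hq : Nonsingular F q) {t m : ℕ}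
    {τ : QF F t} (hτ : Nonsingular F τ) (f : (Fin m → F) →ₗ[F] V)
    (g : (Fin m → F) →ₗ[F] (Fin t → F)) (hg : Function.Injective g)
    (h : ∀ x, q (f x) = τ (g x)) (ht : t < 2 * m) : ReducesBy q τ := by
  have hM : ∀ y ∈ LinearMap.range (f.prod g), q.prod τ y = 0 := by
    rintro _ ⟨x, rfl⟩
    simp [h, CharTwo.add_self_eq_zero]
  have hd : Module.finrank F (LinearMap.range (f.prod g)) = m := by
    rw [LinearMap.finrank_range_of_inj fun x y hxy => hg (Prod.ext_iff.1 hxy).2,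
      Module.finrank_fin_fun]
  obtain ⟨k, ρ, hk, e, he⟩ := (hq.prod hτ).exists_hyperbolic_splitting hM
  rw [Module.finrank_prod, Module.finrank_fin_fun, hd] at hk
  have he' : ((hyperbolicQF F _).prod ρ).Equivalent (q.prod τ) := ⟨⟨e, he⟩⟩
  have hρ : Nonsingular F ρ := ((hq.prod hτ).of_equivalent he'.symm).of_prod_right
  refine ⟨k, by omega, ρ, hρ, Metabolic.of_equivalent ?_ (he'.prod (Equivalent.refl ρ))⟩
  exact metabolic_prodAssoc_iff.2 ((metabolic_hyperbolicQF _).prod (metabolic_prod_self ρ))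

lemma Nonsingular.reducesBy_binQF {q : QuadraticForm F V} (hq : Nonsingular F q) {v u : V}
    {p g : F} (hp : p ≠ 0) (hv : q v = p) (hu : q u = p * g) (hvu : polar q v u = p) :
    ReducesBy q (p • binQF F 1 g) := by
  refine hq.reducesBy ((nonsingular_binQF 1 g).smul hp) (Fintype.linearCombination F ![v, u])
    LinearMap.id Function.injective_id (fun x => ?_) (by norm_num)
  rw [Fintype.linearCombination_apply, Fin.sum_univ_two, smul_apply, LinearMap.id_apply,
    binQF_apply, QuadraticMap.map_add q]
  simp only [Matrix.cons_val, QuadraticMap.map_smul, QuadraticMap.polar_smul_left,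
    QuadraticMap.polar_smul_right, hv, hu, hvu, smul_eq_mul]
  ring

lemma Nonsingular.reducesBy_pf2 {q : QuadraticForm F V} (hq : Nonsingular F q) {v u z : V}
    {p s t : F} (hp : p ≠ 0) (ht : t ≠ 0) (hv : q v = p) (hu : q u = p * s) (hz : q z = p * t)
    (hvu : polar q v u = p) (hvz : polar q v z = 0) (huz : polar q u z = 0) :
    ReducesBy q (p • pf2 F t s) := by
  let g : (Fin 3 → F) →ₗ[F] (Fin 4 → F) :=
    { toFun := fun x => ![x 0, x 1, x 2, 0]
      map_add' := fun x y => by ext i; fin_cases i <;> simp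
      map_smul' := fun c x => by ext i; fin_cases i <;> simp }
  refine hq.reducesBy ((nonsingular_pf2 ht s).smul hp) (Fintype.linearCombination F ![v, u, z])
    g (fun x y h => ?_) (fun x => ?_) (by norm_num)
  · ext i
    fin_cases i
    exacts [congrFun h 0, congrFun h 1, congrFun h 2]
  · rw [Fintype.linearCombination_apply, Fin.sum_univ_three, smul_apply, pf2_apply]
    simp only [QuadraticMap.map_add q, QuadraticMap.polar_add_left, Matrix.cons_val,
      QuadraticMap.map_smul, QuadraticMap.polar_smul_left,
      QuadraticMap.polar_smul_right, hv, hu, hz, hvu, hvz, huz, smul_eq_mul, g,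
      LinearMap.coe_mk, AddHom.coe_mk]
    ring

lemma Nonsingular.exists_reducesBy_pf2 {q : QuadraticForm F V} (hq : Nonsingular F q) {v u : V}
    {p g : F} (hp : p ≠ 0) (hg : ∀ x, x ^ 2 ≠ g) (hv : q v = p) (hu : q u = p * g)
    (hvu : polar q v u = 0) : g ≠ 0 ∧ ∃ h, ReducesBy q (p • pf2 F g h) := by
  have hg0 : g ≠ 0 := fun h => hg 0 (by simp [h])
  have hind : LinearIndependent F ![v, u] := by
    rw [LinearIndependent.pair_iff]
    intro x y hxy
    have h1 : q (x • v + y • u) = 0 := by rw [hxy, QuadraticMap.map_zero]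
    rw [QuadraticMap.map_add q, QuadraticMap.map_smul, QuadraticMap.map_smul,
      QuadraticMap.polar_smul_left, QuadraticMap.polar_smul_right, hv, hu, hvu] at h1
    simp only [smul_eq_mul, mul_zero, add_zero] at h1
    have h2 : x ^ 2 + y ^ 2 * g = 0 := by
      apply mul_left_cancel₀ hp
      linear_combination h1
    have hy : y = 0 := by
      by_contra hy
      refine hg (x / y) ?_
      rw [div_pow, div_eq_iff (pow_ne_zero 2 hy), mul_comm]
      exact CharTwo.add_eq_zero.1 h2
    subst hy
    simpa using h2
  obtain ⟨w, hw⟩ := hq.exists_polar_eq hind ![p, 0]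
  have hw0 : polar q v w = p := hw 0
  have hw1 : polar q u w = 0 := hw 1
  refine ⟨hg0, q w / p, hq.reducesBy_pf2 hp hg0 hv (u := w) (z := u) ?_ hu hw0 hvu ?_⟩
  · field_simp
  · rwa [QuadraticMap.polar_comm]

lemma Nonsingular.reducesBy_pf3 {q : QuadraticForm F V} (hq : Nonsingular F q)
    {v w v' w' u : V} {p b d h : F} (hp : p ≠ 0) (hb : b ≠ 0) (hd : d ≠ 0)
    (hv : q v = p) (hw : q w = p * h) (hv' : q v' = d * p) (hw' : q w' = d * (p * h))
    (hu : q u = b * p) (hvw : polar q v w = p) (hvv' : polar q v v' = 0)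
    (hvw' : polar q v w' = 0) (hvu : polar q v u = 0) (hwv' : polar q w v' = 0)
    (hww' : polar q w w' = 0) (hwu : polar q w u = 0) (hv'w' : polar q v' w' = d * p)
    (hv'u : polar q v' u = 0) (hw'u : polar q w' u = 0) :
    ReducesBy q (p • pf3 F b d h) := by
  let g : (Fin 5 → F) →ₗ[F] (Fin 8 → F) :=
    { toFun := fun x => ![x 0, x 1, x 2, x 3, x 4, 0, 0, 0]
      map_add' := fun x y => by ext i; fin_cases i <;> simp
      map_smul' := fun c x => by ext i; fin_cases i <;> simp }
  refine hq.reducesBy ((nonsingular_pf3 hb hd h).smul hp)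
    (Fintype.linearCombination F ![v, w, v', w', u]) g (fun x y h => ?_) (fun x => ?_)
    (by norm_num)
  · ext i
    fin_cases i
    exacts [congrFun h 0, congrFun h 1, congrFun h 2, congrFun h 3, congrFun h 4]
  · rw [Fintype.linearCombination_apply, Fin.sum_univ_five, smul_apply, pf3_apply]
    simp only [QuadraticMap.map_add q, QuadraticMap.polar_add_left, Matrix.cons_val,
      QuadraticMap.map_smul, QuadraticMap.polar_smul_left, QuadraticMap.polar_smul_right,
      hv, hw, hv', hw', hu, hvw, hvv', hvw', hvu, hwv', hww', hwu, hv'w', hv'u, hw'u,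
      smul_eq_mul, g, LinearMap.coe_mk, AddHom.coe_mk]
    ring

end Reduction

section QuarticExtension

variable {F}
variable {E : Type} [Field E] [Algebra F E] {a b c d : F} {α : E}

/-- `1, α, α², α³` are linearly independent over `F`. -/
def PowersIndependent (F : Type) [Field F] {E : Type} [Field E] [Algebra F E] (α : E) : Prop :=
  ∀ x₀ x₁ x₂ x₃ : F, algebraMap F E x₀ + algebraMap F E x₁ * α + algebraMap F E x₂ * α ^ 2 +
    algebraMap F E x₃ * α ^ 3 = 0 → x₀ = 0 ∧ x₁ = 0 ∧ x₂ = 0 ∧ x₃ = 0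

lemma powersIndependent_of_adjoin_eq_top (hdim : Module.finrank F E = 4)
    (hE : IntermediateField.adjoin F {α} = ⊤) : PowersIndependent F α := by
  have : FiniteDimensional F E := FiniteDimensional.of_finrank_pos (by omega)
  have hdeg : (minpoly F α).natDegree = 4 := by
    rw [← IntermediateField.adjoin.finrank (Algebra.IsIntegral.isIntegral α), hE,
      IntermediateField.finrank_top', hdim]
  have hli := linearIndependent_pow (K := F) α
  rw [hdeg, Fintype.linearIndependent_iff] at hli
  intro x₀ x₁ x₂ x₃ h
  have h1 := hli ![x₀, x₁, x₂, x₃] (by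
    simp only [Fin.sum_univ_four, Matrix.cons_val, Algebra.smul_def]
    rw [← h]
    simp)
  exact ⟨h1 0, h1 1, h1 2, h1 3⟩

lemma PowersIndependent.ne_zero (hα : PowersIndependent F α)
    (hf : α ^ 4 + algebraMap F E a * α ^ 3 + algebraMap F E b * α ^ 2
        + algebraMap F E c * α + algebraMap F E d = 0) : d ≠ 0 := by
  rintro rfl
  have hα0 : α ≠ 0 := by
    rintro rfl
    exact one_ne_zero (hα 0 1 0 0 (by simp)).2.1
  refine one_ne_zero (hα c b a 1 ?_).2.2.2
  apply mul_left_cancel₀ hα0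
  rw [map_zero] at hf
  rw [map_one]
  linear_combination hf

/-- If an anisotropic form becomes metabolic over `F(α)`, a Lagrangian contains, for each `v`,
a unique vector of the form `B v + α A v + α² v`. -/
lemma exists_operators [CharP F 2] (hdim : Module.finrank F E = 4) (hα : PowersIndependent F α)
    (hf : α ^ 4 + algebraMap F E a * α ^ 3 + algebraMap F E b * α ^ 2
        + algebraMap F E c * α + algebraMap F E d = 0) {n : ℕ} {φ : QF F n}
    (hφ : φ.Anisotropic) (hm : Metabolic (extQF F E φ)) :
    ∃ A B : (Fin n → F) →ₗ[F] (Fin n → F), ∀ v, φ (B v) = d * φ v ∧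
      polar φ (A v) (B v) = c * φ v ∧ φ (A v) + polar φ (B v) v = b * φ v ∧
      polar φ (A v) v = a * φ v := by
  have : CharP E 2 := charP_of_injective_algebraMap (algebraMap F E).injective 2
  have : FiniteDimensional F E := FiniteDimensional.of_finrank_pos (by omega)
  obtain ⟨L, hL, hd⟩ := hm
  let ι := Pi.algebraMap (Fin n) F E
  let Ψ : ((Fin n → F) × (Fin n → F) × (Fin n → F)) →ₗ[F] (Fin n → E) :=
    ι.coprod ((α • ι).coprod (α ^ 2 • ι))
  have hΨ : ∀ x, Ψ x = ι x.1 + α • ι x.2.1 + α ^ 2 • ι x.2.2 := fun x => by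
    simp [Ψ, add_assoc]
  let K := LinearMap.ker ((L.mkQ.restrictScalars F).comp Ψ)
  have hKL : ∀ x ∈ K, Ψ x ∈ L := fun x hx => (Submodule.Quotient.mk_eq_zero L).1 hx
  have hK : n ≤ Module.finrank F K := by
    have h1 := LinearMap.finrank_range_add_finrank_ker ((L.mkQ.restrictScalars F).comp Ψ)
    have h2 := Submodule.finrank_le (LinearMap.range ((L.mkQ.restrictScalars F).comp Ψ))
    have h3 := Module.finrank_mul_finrank F E ((Fin n → E) ⧸ L)
    have h4 := Submodule.finrank_quotient_add_finrank L
    simp only [Module.finrank_prod, Module.finrank_fin_fun] at h1 h4 hd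
    rw [hdim] at h3
    change _ + Module.finrank F K = _ at h1
    omega
  have hval : ∀ x ∈ K, φ x.1 = d * φ x.2.2 ∧ polar φ x.2.1 x.1 = c * φ x.2.2 ∧
      φ x.2.1 + polar φ x.1 x.2.2 = b * φ x.2.2 ∧ polar φ x.2.1 x.2.2 = a * φ x.2.2 := by
    intro x hx
    have h1 := hL _ (hKL x hx)
    rw [hΨ, QuadraticMap.map_add (extQF F E φ), QuadraticMap.map_add (extQF F E φ)] at h1
    simp only [QuadraticMap.polar_add_left, QuadraticMap.map_smul, QuadraticMap.polar_smul_left,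
      QuadraticMap.polar_smul_right, ι, extQF_algebraMap, polar_extQF_algebraMap,
      smul_eq_mul] at h1
    have h2 := hα (φ x.1 + d * φ x.2.2) (polar φ x.2.1 x.1 + c * φ x.2.2)
      (φ x.2.1 + polar φ x.1 x.2.2 + b * φ x.2.2) (polar φ x.2.1 x.2.2 + a * φ x.2.2) (by
        simp only [map_add, map_mul]
        rw [QuadraticMap.polar_comm φ x.2.1 x.1]
        grind)
    exact ⟨CharTwo.add_eq_zero.1 h2.1, CharTwo.add_eq_zero.1 h2.2.1,
      CharTwo.add_eq_zero.1 h2.2.2.1, CharTwo.add_eq_zero.1 h2.2.2.2⟩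
  let π : K →ₗ[F] (Fin n → F) :=
    (LinearMap.snd F _ _ ∘ₗ LinearMap.snd F _ _) ∘ₗ K.subtype
  have hπ : Function.Injective π := by
    rw [injective_iff_map_eq_zero]
    intro x hx
    change x.1.2.2 = 0 at hx
    obtain ⟨h1, -, h3, -⟩ := hval x x.2
    rw [hx, QuadraticMap.map_zero, mul_zero] at h1 h3
    rw [QuadraticMap.polar_zero_right, add_zero] at h3
    exact Subtype.ext (Prod.ext (hφ _ h1) (Prod.ext (hφ _ h3) hx))
  have hπd : Module.finrank F K = Module.finrank F (Fin n → F) :=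
    le_antisymm (LinearMap.finrank_le_finrank_of_injective hπ) (by simpa using hK)
  let σ := (LinearEquiv.ofInjectiveOfFinrankEq π hπ hπd).symm
  have hσ : ∀ v, (σ v).1.2.2 = v := fun v =>
    (LinearEquiv.ofInjectiveOfFinrankEq π hπ hπd).apply_symm_apply v
  refine ⟨(LinearMap.fst F _ _ ∘ₗ LinearMap.snd F _ _) ∘ₗ K.subtype ∘ₗ σ.toLinearMap,
    LinearMap.fst F _ _ ∘ₗ K.subtype ∘ₗ σ.toLinearMap, fun v => ?_⟩
  have h := hval (σ v) (σ v).2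
  rw [hσ] at h
  exact h

end QuarticExtension

section Reduction

variable {F}

lemma Metabolic.congr_left {V₁ V₂ V₃ : Type} [AddCommGroup V₁] [Module F V₁] [AddCommGroup V₂]
    [Module F V₂] [AddCommGroup V₃] [Module F V₃] [FiniteDimensional F V₁]
    [FiniteDimensional F V₃] {q₁ : QuadraticForm F V₁} {q₂ : QuadraticForm F V₂}
    {q₃ : QuadraticForm F V₃} (h : Metabolic (q₁.prod q₃)) (e : q₁.Equivalent q₂) :
    Metabolic (q₂.prod q₃) :=
  e.elim fun f => h.of_isometry (f.toLinearEquiv.prodCongr (LinearEquiv.refl F V₃)) fun x =>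
    congrArg (· + q₃ x.2) (f.map_app x.1)

variable [CharP F 2] {E : Type} [Field E] [Algebra F E] {a b c d : F} {α : E} {N : ℕ} {φ : QF F N}

lemma Nonsingular.exists_metabolic_prod {V : Type} [AddCommGroup V] [Module F V]
    [FiniteDimensional F V] {q : QuadraticForm F V} (hq : Nonsingular F q) {x : V}
    (hx : q x = 0) (hx0 : x ≠ 0) :
    ∃ k < Module.finrank F V, ∃ ρ : QF F k, Nonsingular F ρ ∧ Metabolic (q.prod ρ) := by
  obtain ⟨k, ρ, hk, f, hf⟩ := hq.exists_hyperbolic_splitting (M := F ∙ x) (by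
    intro y hy
    obtain ⟨r, rfl⟩ := Submodule.mem_span_singleton.1 hy
    rw [QuadraticMap.map_smul, hx, smul_zero])
  have hm := finrank_span_singleton (K := F) hx0
  generalize Module.finrank F (F ∙ x) = m at hm hk f hf
  have he : ((hyperbolicQF F m).prod ρ).Equivalent q := ⟨⟨f, hf⟩⟩
  exact ⟨k, by omega, ρ, (hq.of_equivalent he.symm).of_prod_right, (metabolic_prodAssoc_iff.2
    ((metabolic_hyperbolicQF m).prod (metabolic_prod_self ρ))).congr_left he⟩

lemma reducesBy_of_polar_ne_zero (hα : PowersIndependent F α)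
    (hf : α ^ 4 + algebraMap F E a * α ^ 3 + algebraMap F E b * α ^ 2
        + algebraMap F E c * α + algebraMap F E d = 0)
    (hns : Nonsingular F φ) {v v' u : Fin N → F} (hv : φ v ≠ 0) (hv' : φ v' = d * φ v)
    (huv' : polar φ u v' = c * φ v) (hu : φ u + polar φ v' v = b * φ v)
    (huv : polar φ u v = a * φ v) (hε : polar φ v' v ≠ 0) :
    ∃ p : F, p ≠ 0 ∧ ∃ x, IsQuarticGen F E a b c d (a = 0 ∧ c = 0 ∧ b ≠ 0) x ∧
      ReducesBy φ (p • x.2) := by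
  have : CharP E 2 := charP_of_injective_algebraMap (algebraMap F E).injective 2
  obtain ⟨e, he⟩ : ∃ e, polar φ v' v = e * φ v := ⟨polar φ v' v / φ v, by field_simp⟩
  have he0 : e ≠ 0 := by rintro rfl; simp [he] at hε
  have hw : φ (e⁻¹ • v') = φ v * (d / e ^ 2) := by
    rw [QuadraticMap.map_smul, hv', smul_eq_mul]; field_simp
  have hvw : polar φ v (e⁻¹ • v') = φ v := by
    rw [QuadraticMap.polar_smul_right, polar_comm, he, smul_eq_mul]; field_simp
  by_cases hC : cubicResolvent F a b c d e = 0
  · refine ⟨φ v, hv, ⟨2, binQF F 1 (d / e ^ 2)⟩, Or.inl ⟨_, ?_, rfl⟩,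
      hns.reducesBy_binQF hv rfl hw hvw⟩
    have hX : algebraMap F E e + algebraMap F E a * α ≠ 0 := fun h =>
      he0 (hα e a 0 0 (by simpa using h)).1
    have hE0 : algebraMap F E e ≠ 0 := by simpa using he0
    refine ⟨(algebraMap F E c * α + algebraMap F E e * α ^ 2) /
      (algebraMap F E e * (algebraMap F E e + algebraMap F E a * α)), ?_⟩
    have hC' := congrArg (algebraMap F E) hC
    simp only [cubicResolvent, map_add, map_mul, map_pow, map_zero] at hC'
    rw [map_div₀, map_pow]
    obtain ⟨X, hXe⟩ : ∃ X, X = algebraMap F E e + algebraMap F E a * α := ⟨_, rfl⟩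
    rw [← hXe] at hX ⊢
    field_simp
    grind
  · refine ⟨φ v, hv, ⟨4, pf2 F (cubicResolvent F a b c d e) (d / e ^ 2)⟩,
      Or.inr (Or.inr (Or.inl ⟨e, he0, hC, rfl⟩)),
      hns.reducesBy_pf2 (z := c • v + a • v' + e • u) hv hC rfl hw ?_ hvw ?_ ?_⟩
    · rw [QuadraticMap.map_add φ, QuadraticMap.map_add φ]
      simp only [QuadraticMap.map_smul, QuadraticMap.polar_add_left, QuadraticMap.polar_smul_left,
        QuadraticMap.polar_smul_right, smul_eq_mul, cubicResolvent]
      rw [polar_comm φ v v', polar_comm φ v u, polar_comm φ v' u]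
      grind
    · simp only [QuadraticMap.polar_add_right, QuadraticMap.polar_smul_right, smul_eq_mul,
        polar_self_eq_zero]
      rw [polar_comm φ v v', polar_comm φ v u]
      grind
    · simp only [QuadraticMap.polar_add_right, QuadraticMap.polar_smul_right,
        QuadraticMap.polar_smul_left, smul_eq_mul, polar_self_eq_zero]
      rw [polar_comm φ v' u]
      grind

lemma reducesBy_of_sqrt {g : F} {β : E} (hns : Nonsingular F φ) {v u : Fin N → F} (hv : φ v ≠ 0)
    (hg : ∀ x, x ^ 2 ≠ g) (hβ : β ^ 2 = algebraMap F E g) (hu : φ u = φ v * g)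
    (hvu : polar φ v u = 0) :
    ∃ p : F, p ≠ 0 ∧ ∃ x, IsQuarticGen F E a b c d (a = 0 ∧ c = 0 ∧ b ≠ 0) x ∧
      ReducesBy φ (p • x.2) := by
  obtain ⟨hg0, h, hh⟩ := hns.exists_reducesBy_pf2 hv hg rfl hu hvu
  exact ⟨φ v, hv, ⟨4, pf2 F g h⟩, Or.inr (Or.inl ⟨g, h, hg0, ⟨β, hβ⟩, rfl⟩), hh⟩

lemma eq_zero_of_norm_relation (hb : ∀ μ, μ ^ 2 ≠ b)
    (hrel : ∀ x y z, x ^ 2 + d * y ^ 2 + b * z ^ 2 = 0 → y = 0) {x₀ x₁ x₂ x₃ : F}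
    (h : x₀ ^ 2 + d * x₁ ^ 2 + b * x₂ ^ 2 + b * d * x₃ ^ 2 = 0) :
    x₀ = 0 ∧ x₁ = 0 ∧ x₂ = 0 ∧ x₃ = 0 := by
  have hsq : ∀ x y, x ^ 2 + b * y ^ 2 = 0 → x = 0 ∧ y = 0 := fun x y hxy => by
    have hy : y = 0 := by
      by_contra hy
      refine hb (x / y) ?_
      field_simp
      linear_combination CharTwo.add_eq_zero.1 hxy
    subst hy
    exact ⟨by simpa using hxy, rfl⟩
  have h1 := hrel (x₀ * x₁ + b * (x₂ * x₃)) (x₁ ^ 2 + b * x₃ ^ 2) (x₀ * x₃ + x₁ * x₂) (by grind)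
  obtain ⟨h₁, h₃⟩ := hsq _ _ h1
  subst h₁ h₃
  obtain ⟨h₀, h₂⟩ := hsq x₀ x₂ (by simpa using h)
  exact ⟨h₀, rfl, h₂, rfl⟩

lemma reducesBy_of_biquadratic (hd : d ≠ 0) (hns : Nonsingular F φ)
    {A B : (Fin N → F) →ₗ[F] (Fin N → F)} (hB : ∀ v, φ (B v) = d * φ v)
    (hAB : ∀ v, polar φ (A v) (B v) = 0) (hA : ∀ v, φ (A v) = b * φ v)
    (hAv : ∀ v, polar φ (A v) v = 0) (hBv : ∀ v, polar φ (B v) v = 0)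
    (hb : ∀ μ, μ ^ 2 ≠ b) (hrel : ∀ x y z, x ^ 2 + d * y ^ 2 + b * z ^ 2 = 0 → y = 0)
    {v : Fin N → F} (hv : φ v ≠ 0) : ∃ h, ReducesBy φ (φ v • pf3 F b d h) := by
  have hpB : ∀ x y, polar φ (B x) (B y) = d * polar φ x y := fun x y => by
    rw [polar, ← map_add, hB, hB, hB, polar]; ring
  have hBc : ∀ x y, polar φ (B x) y = polar φ x (B y) := fun x y => by
    have h := hBv (x + y)
    rw [map_add, QuadraticMap.polar_add_left, QuadraticMap.polar_add_right,
      QuadraticMap.polar_add_right, hBv, hBv, zero_add, add_zero, CharTwo.add_eq_zero,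
      polar_comm φ (B y)] at h
    exact h
  have hvB : ∀ x, polar φ x (B x) = 0 := fun x => by rw [polar_comm, hBv]
  have hvA : ∀ x, polar φ x (A x) = 0 := fun x => by rw [polar_comm, hAv]
  have hBA : ∀ x, polar φ (B x) (A x) = 0 := fun x => by rw [polar_comm, hAB]
  have hvBA : polar φ v (B (A v)) = 0 := by rw [← hBc, hBA]
  have hBBA : polar φ (B v) (B (A v)) = 0 := by rw [hpB, hvA, mul_zero]
  have hind : LinearIndependent F ![v, B v, A v, B (A v)] := by
    rw [Fintype.linearIndependent_iff]
    intro x hx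
    have h1 := congrArg φ hx
    rw [Fin.sum_univ_four, QuadraticMap.map_add φ, QuadraticMap.map_add φ,
      QuadraticMap.map_add φ] at h1
    simp only [Matrix.cons_val, QuadraticMap.map_smul, QuadraticMap.polar_add_left,
      QuadraticMap.polar_smul_left, QuadraticMap.polar_smul_right, hvB, hvA, hBA, hvBA, hBBA, hB,
      hA, QuadraticMap.map_zero, smul_eq_mul] at h1
    obtain ⟨h₀, h₁, h₂, h₃⟩ := eq_zero_of_norm_relation hb hrel
      (x₀ := x 0) (x₁ := x 1) (x₂ := x 2) (x₃ := x 3)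
      (mul_left_cancel₀ hv (by linear_combination h1))
    intro i
    fin_cases i <;> assumption
  obtain ⟨w, hw⟩ := hns.exists_polar_eq hind ![φ v, 0, 0, 0]
  have hvw : polar φ v w = φ v := hw 0
  have hBvw : polar φ (B v) w = 0 := hw 1
  have hAvw : polar φ (A v) w = 0 := hw 2
  have hBAvw : polar φ (B (A v)) w = 0 := hw 3
  have hb0 : b ≠ 0 := fun h => hb 0 (by simp [h])
  have hφw : φ w = φ v * (φ w / φ v) := by field_simp
  refine ⟨φ w / φ v, hns.reducesBy_pf3 (v := v) (w := w) (v' := B v) (w' := B w) (u := A v) hv hb0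
    hd rfl hφw (hB v) (by rw [hB, ← hφw]) (hA v) hvw (hvB v) (by rw [← hBc, hBvw]) (hvA v)
    (by rw [polar_comm, hBvw]) (hvB w) (by rw [polar_comm, hAvw]) (by rw [hpB, hvw]) (hBA v)
    (by rw [hBc, polar_comm, hBAvw])⟩

/-- An anisotropic form in the kernel can be simplified by subtracting a multiple of one of
the generators. -/
lemma exists_generator_reducesBy (hα : PowersIndependent F α)
    (hf : α ^ 4 + algebraMap F E a * α ^ 3 + algebraMap F E b * α ^ 2
        + algebraMap F E c * α + algebraMap F E d = 0)
    (hdim : Module.finrank F E = 4)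
    (hnorm : (b = 0 ∧ a ≠ 0) ∨ (a = 0 ∧ c = 0 ∧ b ≠ 0) ∨ (a = 0 ∧ b = 0 ∧ c = 0))
    (hns : Nonsingular F φ) (hφ : φ.Anisotropic) (hm : Metabolic (extQF F E φ))
    {v : Fin N → F} (hv0 : v ≠ 0) :
    ∃ p : F, p ≠ 0 ∧ ∃ x, IsQuarticGen F E a b c d (a = 0 ∧ c = 0 ∧ b ≠ 0) x ∧
      ReducesBy φ (p • x.2) := by
  have : CharP E 2 := charP_of_injective_algebraMap (algebraMap F E).injective 2
  obtain ⟨A, B, hAB⟩ := exists_operators hdim hα hf hφ hm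
  by_cases hε : ∃ v, polar φ (B v) v ≠ 0
  · obtain ⟨v, hε⟩ := hε
    obtain ⟨h1, h2, h3, h4⟩ := hAB v
    have hv : φ v ≠ 0 := fun h => hε (by rw [hφ v h, QuadraticMap.polar_zero_right])
    exact reducesBy_of_polar_ne_zero hα hf hns hv h1 h2 h3 h4 hε
  push Not at hε
  have hv : φ v ≠ 0 := fun h => hv0 (hφ v h)
  have hA : ∀ v, φ (A v) = b * φ v := fun v => by simpa [hε] using (hAB v).2.2.1
  by_cases hac : a = 0 ∧ c = 0
  swap
  · obtain ⟨rfl, ha⟩ : b = 0 ∧ a ≠ 0 := by tauto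
    have hAv : A v = 0 := hφ _ (by rw [hA, zero_mul])
    have h4 := (hAB v).2.2.2
    rw [hAv, QuadraticMap.polar_zero_left] at h4
    exact absurd h4.symm (mul_ne_zero ha hv)
  obtain ⟨rfl, rfl⟩ := hac
  simp only [zero_mul, map_zero, add_zero] at hAB hf
  by_cases hb : ∃ μ, μ ^ 2 = b
  · obtain ⟨μ, rfl⟩ := hb
    rw [map_pow] at hf
    have hsq : (α ^ 2 + algebraMap F E μ * α) ^ 2 = algebraMap F E d := by grind
    refine reducesBy_of_sqrt hns hv (fun x hx => ?_) hsq
      (by rw [(hAB v).1, mul_comm]) (by rw [polar_comm, hε])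
    rw [← hx, map_pow] at hsq
    have h := CharTwo.add_eq_zero.2 (CharTwo.sq_injective hsq)
    refine one_ne_zero (hα x μ 1 0 ?_).2.2.1
    rw [map_one, map_zero]
    linear_combination h
  push Not at hb
  by_cases hrel : ∀ x y z, x ^ 2 + d * y ^ 2 + b * z ^ 2 = 0 → y = 0
  · obtain ⟨h, hh⟩ := reducesBy_of_biquadratic (hα.ne_zero (a := 0) (b := b) (c := 0) (by simpa))
      hns (fun v => (hAB v).1) (fun v => (hAB v).2.1) hA (fun v => (hAB v).2.2.2) hε hb hrel hv
    exact ⟨φ v, hv, ⟨8, pf3 F b d h⟩,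
      Or.inr (Or.inr (Or.inr ⟨⟨rfl, rfl, fun h => hb 0 (by simp [h])⟩, h, rfl⟩)), hh⟩
  · push Not at hrel
    obtain ⟨x, y, z, hxyz, hy⟩ := hrel
    have hy' : algebraMap F E y ≠ 0 := by simpa using hy
    have hX : algebraMap F E y * α + algebraMap F E z ≠ 0 := fun h =>
      hy (hα z y 0 0 (by rw [map_zero]; linear_combination h)).2.1
    have hE := congrArg (algebraMap F E) hxyz
    simp only [map_add, map_mul, map_pow, map_zero] at hE
    refine reducesBy_of_sqrt hns hv hb (β := (algebraMap F E y * α ^ 2 + algebraMap F E x) /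
      (algebraMap F E y * α + algebraMap F E z)) ?_ (by rw [hA, mul_comm])
      (by rw [polar_comm, (hAB v).2.2.2])
    field_simp
    grind

theorem exists_metabolic_prod_listOSum (hα : PowersIndependent F α)
    (hf : α ^ 4 + algebraMap F E a * α ^ 3 + algebraMap F E b * α ^ 2
        + algebraMap F E c * α + algebraMap F E d = 0)
    (hdim : Module.finrank F E = 4)
    (hnorm : (b = 0 ∧ a ≠ 0) ∨ (a = 0 ∧ c = 0 ∧ b ≠ 0) ∨ (a = 0 ∧ b = 0 ∧ c = 0))
    (hns : Nonsingular F φ) (hm : Metabolic (extQF F E φ)) :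
    ∃ L : List (F × (Σ n, QF F n)),
      (∀ p ∈ L, p.1 ≠ 0 ∧ IsQuarticGen F E a b c d (a = 0 ∧ c = 0 ∧ b ≠ 0) p.2) ∧
      Metabolic (φ.prod (listOSum F (L.map fun p => ⟨p.2.1, p.1 • p.2.2⟩)).2) := by
  have : CharP E 2 := charP_of_injective_algebraMap (algebraMap F E).injective 2
  have hd := hα.ne_zero hf
  induction N using Nat.strong_induction_on with
  | _ N ih =>
  by_cases hM : Metabolic φ
  · exact ⟨[], by simp, metabolic_prod_zero hM⟩
  by_cases hφ : φ.Anisotropic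
  · obtain ⟨v, hv⟩ : ∃ v : Fin N → F, v ≠ 0 := by
      by_contra! h
      exact hM (Metabolic.of_injective (U := Fin N → F) LinearMap.id Function.injective_id
        (fun u => by rw [h u, map_zero, QuadraticMap.map_zero]) (by omega))
    obtain ⟨p, hp, x, hx, n, hn, q', hq', hred⟩ :=
      exists_generator_reducesBy hα hf hdim hnorm hns hφ hm hv
    rw [Module.finrank_fin_fun] at hn
    have hτ : Metabolic (extQF F E (p • x.2)) := by
      rw [extQF_smul]
      exact metabolic_smul (hx.metabolic_extQF hd hf) _
    have hqm : Metabolic (extQF F E q') := by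
      have h1 := (hred.congr_left (oSum_equivalent φ (p • x.2))).extQF_prod (E := E)
      refine h1.swap.cancel (hns.oSum ((hx.nonsingular hd).smul hp)).extQF ?_
      rw [extQF_oSum]
      exact (hm.prod hτ).of_equivalent (oSum_equivalent _ _)
    obtain ⟨L, hL, hLm⟩ := ih n hn hq' hqm
    refine ⟨(p, x) :: L, ?_, ?_⟩
    · rw [List.forall_mem_cons]
      exact ⟨⟨hp, hx⟩, hL⟩
    · exact ((metabolic_prodAssoc_iff.1 (hred.trans hq' hLm)).swap.congr_left
        (oSum_equivalent _ _)).swap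
  · obtain ⟨x, hx, hx0⟩ : ∃ x, φ x = 0 ∧ x ≠ 0 := by
      simpa [QuadraticMap.Anisotropic] using hφ
    obtain ⟨k, hk, ρ, hρ, hφρ⟩ := hns.exists_metabolic_prod hx hx0
    rw [Module.finrank_fin_fun] at hk
    obtain ⟨L, hL, hLm⟩ := ih k hk hρ (hφρ.extQF_prod.swap.cancel hns.extQF hm)
    exact ⟨L, hL, hφρ.trans hρ hLm⟩

end Reduction

/-- Main theorem: for a simple quartic extension `E = F(α)` in characteristic 2
with normalized minimal polynomial `f(X) = X⁴ + aX³ + bX² + cX + d`, the kernel `W_q(E/F)` is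
generated as a `WF`-module by the generators of types (a)–(d): a nonsingular form `φ` has Witt
class in `W_q(E/F)` iff `φ` is Witt equivalent to an orthogonal sum of scalar multiples of such
generators. -/
theorem stmt_6 (F : Type) [Field F] [CharP F 2] (E : Type) [Field E] [Algebra F E]
    (a b c d : F) (α : E)
    (hα : α ^ 4 + algebraMap F E a * α ^ 3 + algebraMap F E b * α ^ 2
        + algebraMap F E c * α + algebraMap F E d = 0)
    (hdim : Module.finrank F E = 4)
    (hE : IntermediateField.adjoin F {α} = ⊤)
    (hnorm : (b = 0 ∧ a ≠ 0) ∨ (a = 0 ∧ c = 0 ∧ b ≠ 0) ∨ (a = 0 ∧ b = 0 ∧ c = 0))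
    (N : ℕ) (φ : QF F N) (hns : Nonsingular F φ) :
    InWqKernel F E φ ↔
      ∃ L : List (F × (Σ n, QF F n)),
        (∀ p ∈ L, p.1 ≠ 0 ∧ IsQuarticGen F E a b c d (a = 0 ∧ c = 0 ∧ b ≠ 0) p.2) ∧
        WittEquiv F φ (listOSum F (L.map fun p => ⟨p.2.1, p.1 • p.2.2⟩)).2 := by
  have : CharP E 2 := charP_of_injective_algebraMap (algebraMap F E).injective 2
  have hp := powersIndependent_of_adjoin_eq_top hdim hE
  have hd := hp.ne_zero hα
  have hsum : ∀ L : List (F × (Σ n, QF F n)),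
      (∀ p ∈ L, p.1 ≠ 0 ∧ IsQuarticGen F E a b c d (a = 0 ∧ c = 0 ∧ b ≠ 0) p.2) →
      Nonsingular F (listOSum F (L.map fun p => ⟨p.2.1, p.1 • p.2.2⟩)).2 := fun L hL => by
    refine nonsingular_listOSum (List.forall_mem_map.2 fun p hpL => ?_)
    exact ((hL p hpL).2.nonsingular hd).smul (hL p hpL).1
  rw [inWqKernel_iff_metabolic hns]
  constructor
  · intro hm
    obtain ⟨L, hL, hLm⟩ := exists_metabolic_prod_listOSum hp hα hdim hnorm hns hm
    exact ⟨L, hL, wittEquiv_of_metabolic hns (hsum L hL) hLm⟩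
  · rintro ⟨L, hL, hw⟩
    refine hw.metabolic.extQF_prod.cancel (hsum L hL).extQF
      (metabolic_extQF_listOSum (List.forall_mem_map.2 fun p hpL => ?_))
    rw [extQF_smul]
    exact metabolic_smul ((hL p hpL).2.metabolic_extQF hd hα) _
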